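/- For every ε > 0 and every θ with 0 < θ < 1 there is a constant c depending only on n, R, d, ε, θ (not on C or C̃) such that for every α ∈ [0,1)^R and every P ≥ 1 at least one of the following holds: (i) |S(α)| ≤ c P^{n − Kθ + ε}; (ii) there exist a ∈ (ℤ_{≥0})^R and q ∈ ℤ_{>0} with gcd(a_1, …, a_R, q) = 1, max_i |q α_i − a_i| ≤ C̃^{R−1} P^{−d + R(d−1)θ} and 1 ≤ q ≤ C̃^R P^{R(d−1)θ}. -/

import Mathlib

open MeasureTheory Filter MvPolynomial

noncomputable section

/-- `e t = exp (2 π i t)` -/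
def eC (t : ℝ) : ℂ := Complex.exp (2 * (Real.pi : ℂ) * Complex.I * (t : ℂ))

abbrev Qbar : Type := AlgebraicClosure ℚ

/-- Dimension of the affine singular locus of `g` (the common zero set of the partial
derivatives of `g`), as the Krull dimension of its coordinate ring. -/
def singDim (n : ℕ) (g : MvPolynomial (Fin n) Qbar) : WithBot ℕ∞ :=
  ringKrullDim (MvPolynomial (Fin n) Qbar ⧸
    Ideal.span (Set.range fun j : Fin n => MvPolynomial.pderiv j g))

/-- `Δ = max_{b ∈ ℤ^R \ {0}} dim Sing(b₁ g₁ + ⋯ + b_R g_R)`. -/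
def birchDelta (n R : ℕ) (g : Fin R → MvPolynomial (Fin n) ℤ) : WithBot ℕ∞ :=
  ⨆ (b : Fin R → ℤ) (_ : b ≠ 0),
    singDim n (MvPolynomial.map (Int.castRingHom Qbar) (∑ i, b i • g i))

/-- `K = (n - Δ)/2^(d-1)` where `Δ = max_{b ≠ 0} dim Sing(f̃_b)`. -/
def KofDelta (n R d : ℕ) (g : Fin R → MvPolynomial (Fin n) ℤ) (K : ℝ) : Prop :=
  ∃ Δ : ℕ, ((Δ : ℕ∞) : WithBot ℕ∞) = birchDelta n R g ∧
    K = ((n : ℝ) - (Δ : ℝ)) / 2 ^ (d - 1)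

/-- The quantity `R(R+1)(d-1)` as a real number. -/
def BB (R d : ℕ) : ℝ := (R : ℝ) * ((R : ℝ) + 1) * ((d : ℝ) - 1)

/-- The `R × R` minor of the Jacobian matrix of `f` with columns given by the elements
of `I`. -/
def jacMinor {n R : ℕ} (f : Fin R → MvPolynomial (Fin n) ℤ)
    (I : Finset (Fin n)) (hI : I.card = R) : MvPolynomial (Fin n) ℤ :=
  Matrix.det (Matrix.of fun i k : Fin R => MvPolynomial.pderiv (I.orderEmbOfFin hI k) (f i))

/-- `Cv` is the maximum of the absolute values of the coefficients of the `f i`. -/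
def coeffMax {n R : ℕ} (f : Fin R → MvPolynomial (Fin n) ℤ) (Cv : ℝ) : Prop :=
  IsGreatest {x : ℝ | ∃ (i : Fin R) (m : (Fin n) →₀ ℕ), x = |((MvPolynomial.coeff m (f i) : ℤ) : ℝ)|} Cv

/-- The integer points of the dilated box `P𝓑`. -/
def boxPts {n : ℕ} (aB bB : Fin n → ℝ) (P : ℝ) : Finset (Fin n → ℤ) :=
  Finset.Icc (fun j => ⌈P * aB j⌉) (fun j => ⌊P * bB j⌋)

/-- The exponential sum `S(α) = ∑_{x ∈ P𝓑 ∩ ℤ^n} e(α · f(x))`. -/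
def Sexp {n R : ℕ} (f : Fin R → MvPolynomial (Fin n) ℤ) (aB bB : Fin n → ℝ) (P : ℝ)
    (α : Fin R → ℝ) : ℂ :=
  ∑ x ∈ boxPts aB bB P, eC (∑ i, α i * (MvPolynomial.eval x (f i) : ℝ))

/-- The complete exponential sum `S_{a,q} = ∑_{x mod q} e(a · f(x)/q)`. -/
def Sgauss {n R : ℕ} (f : Fin R → MvPolynomial (Fin n) ℤ) (q : ℕ) (a : Fin R → ℤ) : ℂ :=
  ∑ x : Fin n → Fin q,
    eC ((∑ i, (a i : ℝ) * (MvPolynomial.eval (fun j => ((x j : ℕ) : ℤ)) (f i) : ℝ)) / q)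

/-- `S_{a,q}(ν) = S_{a,q} e(-a·ν/q)`. -/
def SgaussNu {n R : ℕ} (f : Fin R → MvPolynomial (Fin n) ℤ) (q : ℕ) (a : Fin R → ℤ)
    (ν : Fin R → ℤ) : ℂ :=
  Sgauss f q a * eC (-(∑ i, (a i : ℝ) * (ν i : ℝ)) / q)

/-- Residues `1 ≤ aᵢ ≤ q` (coded by `Fin q`, shifted by one) with `gcd(a₁, …, a_R, s) = 1`. -/
def resSet (R q s : ℕ) : Finset (Fin R → Fin q) :=
  Finset.univ.filter fun a => Nat.gcd (Finset.univ.gcd fun i => (a i : ℕ) + 1) s = 1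

/-- The singular series `𝔖(ν)`. -/
def singularSeries {n R : ℕ} (f : Fin R → MvPolynomial (Fin n) ℤ) (ν : Fin R → ℤ) : ℂ :=
  ∑' q : ℕ, ((q : ℂ) ^ n)⁻¹ *
    ∑ a ∈ resSet R q q, SgaussNu f q (fun i => ((a i : ℕ) : ℤ) + 1) ν

/-- The local density `𝔖_p(ν)`. -/
def localDensity {n R : ℕ} (f : Fin R → MvPolynomial (Fin n) ℤ) (ν : Fin R → ℤ) (p : ℕ) : ℂ :=
  ∑' r : ℕ, ((p : ℂ) ^ (r * n))⁻¹ *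
    ∑ a ∈ resSet R (p ^ r) p, SgaussNu f (p ^ r) (fun i => ((a i : ℕ) : ℤ) + 1) ν

/-- The box `𝓑 = ∏ⱼ [aⱼ, bⱼ]` as a subset of `ℝ^n`. -/
def boxSet {n : ℕ} (aB bB : Fin n → ℝ) : Set (Fin n → ℝ) :=
  Set.univ.pi fun j => Set.Icc (aB j) (bB j)

/-- The oscillatory integral `I(𝓒, γ) = ∫_{ζ ∈ 𝓒} e(γ · g(ζ)) dζ`. -/
def Iosc {n R : ℕ} (g : Fin R → MvPolynomial (Fin n) ℤ) (C : Set (Fin n → ℝ))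
    (γ : Fin R → ℝ) : ℂ :=
  ∫ ζ in C, eC (∑ i, γ i * MvPolynomial.aeval ζ (g i))

/-- `J(μ, Φ) = ∫_{|γ| ≤ Φ} I(𝓑, γ) e(-γ·μ) dγ`. -/
def Jint {n R : ℕ} (g : Fin R → MvPolynomial (Fin n) ℤ) (aB bB : Fin n → ℝ)
    (μ : Fin R → ℝ) (Φ : ℝ) : ℂ :=
  ∫ γ in {γ : Fin R → ℝ | ∀ i, |γ i| ≤ Φ}, Iosc g (boxSet aB bB) γ * eC (-(∑ i, γ i * μ i))

/-- The singular integral `J(μ) = lim_{Φ → ∞} J(μ, Φ)`. -/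
def Jlim {n R : ℕ} (g : Fin R → MvPolynomial (Fin n) ℤ) (aB bB : Fin n → ℝ)
    (μ : Fin R → ℝ) : ℂ :=
  limUnder Filter.atTop fun Φ : ℝ => Jint g aB bB μ Φ

/-- `M(P, ν)`: the number of integer points `x ∈ P𝓑` with `f(x) = ν`. -/
def Mcount {n R : ℕ} (f : Fin R → MvPolynomial (Fin n) ℤ) (aB bB : Fin n → ℝ) (P : ℝ)
    (ν : Fin R → ℤ) : ℕ :=
  ((boxPts aB bB P).filter fun x => ∀ i, MvPolynomial.eval x (f i) = ν i).card

/-- A single major arc `𝔐_{a,q}(θ)`. -/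
def majorArc {R : ℕ} (d : ℕ) (Ct P θ : ℝ) (q : ℕ) (a : Fin R → ℤ) : Set (Fin R → ℝ) :=
  Set.univ.pi fun i => Set.Icc
    ((a i : ℝ) / q - Ct ^ (R - 1) * P ^ (-(d : ℝ) + (R : ℝ) * ((d : ℝ) - 1) * θ) / (2 * q))
    ((a i : ℝ) / q + Ct ^ (R - 1) * P ^ (-(d : ℝ) + (R : ℝ) * ((d : ℝ) - 1) * θ) / (2 * q))

/-- The major arcs `𝔐(θ)`. -/
def majorArcs (R d : ℕ) (Ct P θ : ℝ) : Set (Fin R → ℝ) :=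
  ⋃ (q : ℕ) (_ : 1 ≤ q ∧ (q : ℝ) ≤ Ct ^ R * P ^ ((R : ℝ) * ((d : ℝ) - 1) * θ))
    (a : Fin R → ℤ)
    (_ : (∀ i, 1 ≤ a i ∧ a i ≤ (q : ℤ)) ∧ Int.gcd (Finset.univ.gcd a) (q : ℤ) = 1),
    majorArc d Ct P θ q a

/-- The minor arcs `𝔪 = [0,1]^R \ 𝔐(θ)`, taken modulo `1`. -/
def minorArcs (R d : ℕ) (Ct P θ : ℝ) : Set (Fin R → ℝ) :=
  {α | (∀ i, 0 ≤ α i ∧ α i ≤ 1) ∧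
    ∀ z : Fin R → ℤ, (fun i => α i + (z i : ℝ)) ∉ majorArcs R d Ct P θ}

/-- Nonsingularity of the affine variety `f = 0` over `ℚ̄`: at every common zero the
Jacobian matrix has (maximal) rank `R`, i.e. some `R × R` minor is nonvanishing. -/
def AffineNonsingular {n : ℕ} (R : ℕ) (f : Fin R → MvPolynomial (Fin n) ℤ) : Prop :=
  ∀ x : Fin n → Qbar, (∀ i, MvPolynomial.aeval x (f i) = 0) →
    ∃ (I : Finset (Fin n)) (hI : I.card = R), MvPolynomial.aeval x (jacMinor f I hI) ≠ 0

/-- Nonsingularity of the projective variety `g = 0` over `ℚ̄` (for forms `g`): at every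
nonzero point of the affine cone the Jacobian matrix has rank `R`. -/
def ProjNonsingular {n : ℕ} (R : ℕ) (g : Fin R → MvPolynomial (Fin n) ℤ) : Prop :=
  ∀ x : Fin n → Qbar, x ≠ 0 → (∀ i, MvPolynomial.aeval x (g i) = 0) →
    ∃ (I : Finset (Fin n)) (hI : I.card = R), MvPolynomial.aeval x (jacMinor g I hI) ≠ 0


def waMu {n r : ℕ} (i : Fin r → Fin n) : Fin n →₀ ℕ := ∑ k, Finsupp.single (i k) 1

def waTr {n r : ℕ} {A : Type*} [CommRing A] (p : MvPolynomial (Fin n) A) (i : Fin r → Fin n) : A :=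
  ((∏ a, (waMu i a).factorial : ℕ) : A) * coeff (waMu i) p

/-- The multilinear form attached to the degree `r` part of `p`. -/
def waM {n r : ℕ} {A : Type*} [CommRing A] (p : MvPolynomial (Fin n) A)
    (h : Fin r → Fin n → A) : A :=
  ∑ i : Fin r → Fin n, waTr p i * ∏ k, h k (i k)

section waMsec
variable {n r : ℕ} {A : Type*} [CommRing A]

lemma waMu_degree (i : Fin r → Fin n) : (waMu i).degree = r := by
  simp [waMu, map_sum]

lemma waMu_cons (a : Fin n) (i : Fin r → Fin n) :
    waMu (Fin.cons a i : Fin (r+1) → Fin n) = waMu i + Finsupp.single a 1 := by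
  simp [waMu, Fin.sum_univ_succ, add_comm]

lemma waTr_cons (p : MvPolynomial (Fin n) A) (a : Fin n) (i : Fin r → Fin n) :
    waTr p (Fin.cons a i : Fin (r+1) → Fin n) = waTr (pderiv a p) i := by
  unfold waTr
  rw [coeff_pderiv, waMu_cons]
  have : (∏ b, ((waMu i + Finsupp.single a 1 : Fin n →₀ ℕ) b).factorial) =
      (∏ b, (waMu i b).factorial) * (waMu i a + 1) := by
    rw [← Finset.mul_prod_erase _ _ (Finset.mem_univ a),
      ← Finset.mul_prod_erase _ (fun b => (waMu i b).factorial) (Finset.mem_univ a)]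
    have h1 : ∏ x ∈ Finset.univ.erase a, ((waMu i + Finsupp.single a 1 : Fin n →₀ ℕ) x).factorial =
      ∏ x ∈ Finset.univ.erase a, (waMu i x).factorial := by
      apply Finset.prod_congr rfl
      intro x hx
      have : a ≠ x := fun h => by simp [h] at hx
      simp [Finsupp.single_apply, this]
    rw [h1]
    simp [Nat.factorial_succ]
    ring
  rw [this]
  push_cast
  ring

lemma waM_cons (p : MvPolynomial (Fin n) A) (h0 : Fin n → A) (h : Fin r → Fin n → A) :
    waM p (Fin.cons h0 h : Fin (r+1) → Fin n → A) = ∑ a, h0 a * waM (pderiv a p) h := by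
  unfold waM
  rw [← (Fin.consEquiv (fun _ => Fin n)).sum_comp, Fintype.sum_prod_type]
  apply Finset.sum_congr rfl
  intro a _
  rw [Finset.mul_sum]
  apply Finset.sum_congr rfl
  intro i _
  simp only [Fin.consEquiv, Equiv.coe_fn_mk, waTr_cons, Fin.prod_univ_succ, Fin.cons_zero,
    Fin.cons_succ]
  ring

lemma waM_perm (p : MvPolynomial (Fin n) A) (h : Fin r → Fin n → A) (s : Equiv.Perm (Fin r)) :
    waM p (fun k => h (s k)) = waM p h := by
  unfold waM
  rw [← (s.arrowCongr (Equiv.refl (Fin n))).sum_comp (fun i => waTr p i * ∏ k, h k (i k))]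
  apply Finset.sum_congr rfl
  intro i _
  have h1 : waMu ((s.arrowCongr (Equiv.refl (Fin n))) i) = waMu i := by
    unfold waMu
    rw [← Equiv.sum_comp s]
    simp [Equiv.arrowCongr]
  have h2 : ∏ k, h k ((s.arrowCongr (Equiv.refl (Fin n))) i k) = ∏ k, h (s k) (i k) := by
    rw [← Equiv.prod_comp s]
    simp [Equiv.arrowCongr]
  rw [h2]
  unfold waTr
  rw [h1]

lemma waM_congr {p q : MvPolynomial (Fin n) A} (hpq : ∀ m : Fin n →₀ ℕ, m.degree = r → coeff m p = coeff m q)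
    (h : Fin r → Fin n → A) : waM p h = waM q h := by
  unfold waM waTr
  apply Finset.sum_congr rfl
  intro i _
  rw [hpq _ (waMu_degree i)]

lemma waM_sum {ι : Type*} (s : Finset ι) (c : ι → A) (p : ι → MvPolynomial (Fin n) A)
    (h : Fin r → Fin n → A) : waM (∑ i ∈ s, c i • p i) h = ∑ i ∈ s, c i * waM (p i) h := by
  unfold waM waTr
  simp_rw [Finset.mul_sum]
  rw [Finset.sum_comm]
  apply Finset.sum_congr rfl
  intro i _
  rw [coeff_sum, Finset.mul_sum, Finset.sum_mul]
  apply Finset.sum_congr rfl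
  intro j _
  simp
  ring

lemma waM_map {B : Type*} [CommRing B] (φ : A →+* B) (p : MvPolynomial (Fin n) A)
    (h : Fin r → Fin n → A) : waM (map φ p) (fun k i => φ (h k i)) = φ (waM p h) := by
  unfold waM waTr
  simp [coeff_map]

lemma waM_update (p : MvPolynomial (Fin n) A) (h : Fin r → Fin n → A) (k : Fin r) (u : Fin n → A) :
    waM p (Function.update h k u) = ∑ a, u a * waM p (Function.update h k (Pi.single a 1)) := by
  have key : ∀ (u : Fin n → A) (i : Fin r → Fin n), ∏ k', Function.update h k u k' (i k') =
      u (i k) * ∏ k' ∈ Finset.univ.erase k, h k' (i k') := by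
    intro u i
    rw [← Finset.mul_prod_erase _ _ (Finset.mem_univ k)]
    congr 1
    · simp
    · apply Finset.prod_congr rfl
      intro x hx
      have : x ≠ k := fun h => by simp [h] at hx
      simp [this]
  unfold waM
  simp_rw [key, Finset.mul_sum]
  rw [Finset.sum_comm]
  apply Finset.sum_congr rfl
  intro i _
  rw [Finset.sum_eq_single (i k)]
  · simp; ring
  · intro b _ hb
    simp [Pi.single_apply, hb.symm]
  · simp

lemma waM_pderiv (p : MvPolynomial (Fin n) A) (h : Fin r → Fin n → A) (j : Fin n) :
    waM (pderiv j p) h = waM p (Fin.cons (Pi.single j 1) h : Fin (r+1) → Fin n → A) := by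
  rw [waM_cons, Finset.sum_eq_single j]
  · simp
  · intro b _ hb; simp [Pi.single_apply, hb]
  · simp

lemma waM_symm (p : MvPolynomial (Fin n) A) (h : Fin r → Fin n → A) (k : Fin r) (j a : Fin n) :
    waM (pderiv j p) (Function.update h k (Pi.single a 1)) =
    waM (pderiv a p) (Function.update h k (Pi.single j 1)) := by
  rw [waM_pderiv, waM_pderiv, ← waM_perm _ _ (Equiv.swap 0 k.succ)]
  congr 1
  ext x
  refine Fin.cases ?_ (fun y => ?_) x
  · simp
  · by_cases hy : y = k
    · subst hy; simp
    · rw [Equiv.swap_apply_of_ne_of_ne (by simp) (by simpa using hy)]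
      simp [hy]

lemma waM_diag (p : MvPolynomial (Fin n) A) (hp : p.IsHomogeneous r) (x : Fin n → A) :
    waM p (fun _ : Fin r => x) = (r.factorial : A) * eval x p := by
  induction r generalizing p with
  | zero =>
    have h0 : p = C (coeff 0 p) := by
      rw [← totalDegree_eq_zero_iff_eq_C]
      exact Nat.le_zero.mp hp.totalDegree_le
    rw [h0]
    simp [waM, waTr, waMu]
  | succ r ih =>
    have : (fun _ : Fin (r+1) => x) = Fin.cons x (fun _ : Fin r => x) := by
      ext k; refine Fin.cases ?_ (fun y => ?_) k <;> simp
    rw [this, waM_cons]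
    have h2 := hp.sum_X_mul_pderiv
    have h3 := congrArg (eval x) h2
    simp only [map_sum, map_mul, eval_X, nsmul_eq_mul, map_natCast] at h3
    calc ∑ a, x a * waM (pderiv a p) (fun _ : Fin r => x)
        = ∑ a, x a * ((r.factorial : A) * eval x (pderiv a p)) := by
          apply Finset.sum_congr rfl
          intro a _
          rw [ih]
          exact hp.pderiv
      _ = (r.factorial : A) * ∑ a, x a * eval x (pderiv a p) := by
          rw [Finset.mul_sum]; apply Finset.sum_congr rfl; intros; ring
      _ = _ := by
          rw [h3, Nat.factorial_succ]; push_cast; ring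
end waMsec

lemma waM_bound {n r : ℕ} (p : MvPolynomial (Fin n) ℤ) (C B : ℝ) (hB : 0 ≤ B)
    (hC : ∀ m : Fin n →₀ ℕ, m.degree = r → |((coeff m p : ℤ) : ℝ)| ≤ C)
    (h : Fin r → Fin n → ℤ) (hh : ∀ k i, |(h k i : ℝ)| ≤ B) :
    |((waM p h : ℤ) : ℝ)| ≤ (n : ℝ)^r * (r.factorial * C * B^r) := by
  unfold waM
  push_cast
  refine (Finset.abs_sum_le_sum_abs _ _).trans ?_
  have : ∀ i ∈ (Finset.univ : Finset (Fin r → Fin n)),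
      |((waTr p i : ℤ) : ℝ) * ∏ k, ((h k (i k) : ℤ) : ℝ)| ≤ r.factorial * C * B^r := by
    intro i _
    have hC0 := (abs_nonneg _).trans (hC _ (waMu_degree i))
    rw [abs_mul, Finset.abs_prod]
    apply mul_le_mul
    · unfold waTr
      push_cast
      rw [abs_mul]
      apply mul_le_mul _ (hC _ (waMu_degree i)) (abs_nonneg _) (by positivity)
      rw [abs_of_nonneg (by positivity)]
      have h1 : (∏ a, (waMu i a).factorial) ∣ (∑ a, waMu i a).factorial :=
        Nat.prod_factorial_dvd_factorial_sum _ _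
      have h2 := waMu_degree i
      rw [Finsupp.degree_eq_sum] at h2
      rw [h2] at h1
      exact_mod_cast Nat.le_of_dvd (Nat.factorial_pos _) h1
    · calc ∏ k, |((h k (i k) : ℤ) : ℝ)| ≤ ∏ k : Fin r, B := Finset.prod_le_prod (fun _ _ => abs_nonneg _) (fun k _ => hh k _)
        _ = B^r := by simp
    · positivity
    · positivity
  refine (Finset.sum_le_card_nsmul _ _ _ this).trans ?_
  simp

section waDiff
variable {n : ℕ} {A : Type*} [CommRing A]

def waDegLt (k : ℕ) (q : MvPolynomial (Fin n) A) : Prop := ∀ m, coeff m q ≠ 0 → m.degree < k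

lemma waDegLt.zero (k : ℕ) : waDegLt k (0 : MvPolynomial (Fin n) A) := by
  intro m hm; simp at hm

lemma waDegLt.add {k : ℕ} {p q : MvPolynomial (Fin n) A} (hp : waDegLt k p) (hq : waDegLt k q) :
    waDegLt k (p + q) := by
  intro m hm
  by_cases h : coeff m p = 0
  · apply hq; simpa [h] using hm
  · exact hp _ h

lemma waDegLt.smul {k : ℕ} {p : MvPolynomial (Fin n) A} (hp : waDegLt k p) (c : A) :
    waDegLt k (c • p) := by
  intro m hm
  apply hp
  intro h; simp [h] at hm

lemma waDegLt.mono {k l : ℕ} (hkl : k ≤ l) {p : MvPolynomial (Fin n) A} (hp : waDegLt k p) :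
    waDegLt l p := fun m hm => (hp m hm).trans_le hkl

lemma waDegLt.sum {ι : Type*} {k : ℕ} (s : Finset ι) (p : ι → MvPolynomial (Fin n) A)
    (hp : ∀ i ∈ s, waDegLt k (p i)) : waDegLt k (∑ i ∈ s, p i) := by
  classical
  induction s using Finset.induction_on with
  | empty => simpa using waDegLt.zero k
  | insert a s ha ih =>
    rw [Finset.sum_insert ha]
    exact (hp a (by simp)).add (ih fun i hi => hp i (by simp [hi]))

lemma waDegLt.mulX {k : ℕ} {p : MvPolynomial (Fin n) A} (hp : waDegLt (k - 1) p) (i : Fin n) :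
    waDegLt k (p * X i) := by
  intro m hm
  rw [coeff_mul_X'] at hm
  split_ifs at hm with h
  · have := hp _ hm
    have h1 : m = (m - Finsupp.single i 1) + Finsupp.single i 1 := by
      rw [tsub_add_cancel_of_le]
      rw [Finsupp.single_le_iff]
      have := Finsupp.mem_support_iff.mp h
      omega
    rw [h1, map_add, Finsupp.degree_single]
    omega
  · exact absurd rfl hm

def waShift (h : Fin n → A) (p : MvPolynomial (Fin n) A) : MvPolynomial (Fin n) A :=
  aeval (fun i => X i + C (h i)) p - p

def waDir (h : Fin n → A) (p : MvPolynomial (Fin n) A) : MvPolynomial (Fin n) A :=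
  ∑ a, h a • pderiv a p

lemma waShift_mulX (h : Fin n → A) (q : MvPolynomial (Fin n) A) (i : Fin n) :
    waShift h (q * X i) = waShift h q * X i + h i • waShift h q + h i • q := by
  unfold waShift
  simp only [map_mul, aeval_X, smul_eq_C_mul]
  ring

lemma waDir_mulX (h : Fin n → A) (q : MvPolynomial (Fin n) A) (i : Fin n) :
    waDir h (q * X i) = waDir h q * X i + h i • q := by
  unfold waDir
  simp only [pderiv_mul, pderiv_X, smul_add, Finset.sum_add_distrib, Finset.sum_mul, smul_mul_assoc]
  congr 1
  rw [Finset.sum_eq_single i]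
  · simp
  · intro b _ hb; simp [Pi.single_apply, hb.symm]
  · simp

lemma waShift_monomial (h : Fin n → A) (k : ℕ) : ∀ m : Fin n →₀ ℕ, m.degree = k →
    waDegLt k (waShift h (monomial m 1)) ∧
    waDegLt (k-1) (waShift h (monomial m 1) - waDir h (monomial m 1)) := by
  induction k with
  | zero =>
    intro m hm
    have : m = 0 := (Finsupp.degree_eq_zero_iff m).mp hm
    subst this
    have h1 : (monomial (0 : Fin n →₀ ℕ) (1:A)) = 1 := rfl
    rw [h1]
    simp [waShift, waDir, pderiv_one, waDegLt.zero]
  | succ k ih =>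
    intro m hm
    have hm0 : m ≠ 0 := by rintro rfl; simp at hm
    obtain ⟨i, hi⟩ := Finsupp.ne_iff.mp hm0
    have h1 : m = (m - Finsupp.single i 1) + Finsupp.single i 1 := by
      rw [tsub_add_cancel_of_le]
      rw [Finsupp.single_le_iff]
      simp at hi
      omega
    set m' := m - Finsupp.single i 1 with hm'
    have h2 : m'.degree = k := by
      rw [h1, map_add, Finsupp.degree_single] at hm; omega
    have h3 : (monomial m (1:A)) = monomial m' 1 * X i := by
      rw [X, monomial_mul, ← h1, one_mul]
    have hq : waDegLt (k+1) (monomial m' (1:A)) := by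
      intro s hs
      rw [coeff_monomial] at hs
      split_ifs at hs with h
      · subst h; omega
      · exact absurd rfl hs
    obtain ⟨ih1, ih2⟩ := ih m' h2
    rw [h3, waShift_mulX, waDir_mulX]
    constructor
    · exact ((waDegLt.mulX (by simpa using ih1) i).add ((ih1.smul _).mono (by omega))).add (hq.smul _)
    · have : waShift h (monomial m' 1) * X i + h i • waShift h (monomial m' 1) + h i • monomial m' 1 -
          (waDir h (monomial m' 1) * X i + h i • monomial m' 1) =
          (waShift h (monomial m' 1) - waDir h (monomial m' 1)) * X i + h i • waShift h (monomial m' 1) := by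
        ring
      rw [this]
      exact (waDegLt.mulX ih2 i).add (ih1.smul _)

lemma waShift_deg (h : Fin n → A) (k : ℕ) (p : MvPolynomial (Fin n) A) (hp : waDegLt (k+1) p) :
    waDegLt k (waShift h p) ∧ waDegLt (k-1) (waShift h p - waDir h p) := by
  have hsum : p = ∑ m ∈ p.support, coeff m p • monomial m 1 := by
    conv_lhs => rw [p.as_sum]
    simp [smul_monomial]
  have e1 : waShift h p = ∑ m ∈ p.support, coeff m p • waShift h (monomial m 1) := by
    conv_lhs => rw [hsum]
    unfold waShift
    rw [map_sum, ← Finset.sum_sub_distrib]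
    simp [smul_sub]
  have e2 : waDir h p = ∑ m ∈ p.support, coeff m p • waDir h (monomial m 1) := by
    conv_lhs => rw [hsum]
    unfold waDir
    simp_rw [map_sum, Finset.smul_sum]
    rw [Finset.sum_comm]
    refine Finset.sum_congr rfl fun m _ => Finset.sum_congr rfl fun a _ => ?_
    rw [Derivation.map_smul, smul_comm]
  rw [e2, e1, ← Finset.sum_sub_distrib]
  constructor
  · refine waDegLt.sum _ _ fun m hm => ?_
    have := hp m (by simpa using hm)
    exact (((waShift_monomial h _ m rfl).1).smul _).mono (by omega)
  · refine waDegLt.sum _ _ fun m hm => ?_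
    rw [← smul_sub]
    have := hp m (by simpa using hm)
    exact (((waShift_monomial h _ m rfl).2).smul _).mono (by omega)

lemma wa_pderiv_comm (a b : Fin n) (p : MvPolynomial (Fin n) A) :
    pderiv a (pderiv b p) = pderiv b (pderiv a p) := by
  ext m
  simp only [coeff_pderiv]
  by_cases hab : a = b
  · subst hab; rfl
  · rw [add_right_comm]
    simp [Finsupp.single_apply, hab, Ne.symm hab]
    ring

end waDiff

lemma wa_degree_one {n : ℕ} (m : Fin n →₀ ℕ) (h : m.degree = 1) : ∃ j, m = Finsupp.single j 1 := by
  have hm0 : m ≠ 0 := by rintro rfl; simp at h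
  obtain ⟨i, hi⟩ := Finsupp.ne_iff.mp hm0
  have h1 : m = (m - Finsupp.single i 1) + Finsupp.single i 1 := by
    rw [tsub_add_cancel_of_le]
    rw [Finsupp.single_le_iff]
    simp at hi
    omega
  refine ⟨i, ?_⟩
  rw [h1, map_add, Finsupp.degree_single] at h
  have := (Finsupp.degree_eq_zero_iff (m - Finsupp.single i 1)).mp (by omega)
  rw [h1, this, zero_add]

def waIter {n : ℕ} : (r : ℕ) → (Fin r → Fin n → ℤ) → ((Fin n → ℤ) → ℝ) → ((Fin n → ℤ) → ℝ)
  | 0, _, ψ => ψ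
  | r+1, h, ψ => waIter r (Fin.tail h) (fun x => ψ (x + h 0) - ψ x)

lemma waIter_eq {n : ℕ} (r : ℕ) : ∀ (p : MvPolynomial (Fin n) ℝ) (_ : waDegLt (r+2) p)
    (h : Fin r → Fin n → ℤ), ∃ c : ℝ, ∀ x : Fin n → ℤ,
    waIter r h (fun x => eval (fun i => (x i : ℝ)) p) x =
      c + ∑ j, (x j : ℝ) * waM (pderiv j p) (fun k i => (h k i : ℝ)) := by
  induction r with
  | zero =>
    intro p hp h
    refine ⟨coeff 0 p, fun x => ?_⟩
    simp only [waIter]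
    have hM : ∀ j, waM (pderiv j p) (fun (k : Fin 0) i => (h k i : ℝ)) = coeff (Finsupp.single j 1) p := by
      intro j
      simp [waM, waTr, waMu, coeff_pderiv]
    simp_rw [hM]
    have : p = C (coeff 0 p) + ∑ j, coeff (Finsupp.single j 1) p • X j := by
      ext m
      rw [coeff_add, coeff_C, coeff_sum]
      simp_rw [coeff_smul, coeff_X']
      by_cases h0 : m = 0
      · subst h0
        simp
      · by_cases h1 : m.degree = 1
        · obtain ⟨j, rfl⟩ := wa_degree_one m h1
          rw [Finset.sum_eq_single j]
          · simp
            intro h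
            exact absurd h.symm h0
          · intro b _ hb
            simp [Finsupp.single_left_inj, hb]
          · simp
        · have hz : coeff m p = 0 := by
            by_contra hne
            have := hp m hne
            have h2 : m.degree ≠ 0 := fun h => h0 ((Finsupp.degree_eq_zero_iff m).mp h)
            omega
          rw [hz, if_neg (Ne.symm h0), Finset.sum_eq_zero]
          · simp
          · intro j _
            rw [if_neg]
            · simp
            · rintro rfl; simp at h1
    conv_lhs => rw [this]
    simp [mul_comm]
  | succ r ih =>
    intro p hp h
    set h0 : Fin n → ℝ := fun i => (h 0 i : ℝ) with hh0
    obtain ⟨d1, d2⟩ := waShift_deg h0 (r+2) p hp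
    obtain ⟨c, hc⟩ := ih (waShift h0 p) d1 (Fin.tail h)
    refine ⟨c, fun x => ?_⟩
    have e1 : (fun x : Fin n → ℤ => eval (fun i => ((x + h 0) i : ℝ)) p - eval (fun i => (x i : ℝ)) p)
        = fun x : Fin n → ℤ => eval (fun i => (x i : ℝ)) (waShift h0 p) := by
      ext x
      unfold waShift
      rw [map_sub]
      congr 1
      rw [← coe_aeval_eq_eval, ← coe_aeval_eq_eval]
      simp only [RingHom.coe_coe]
      rw [← AlgHom.comp_apply, comp_aeval]
      simp [h0]
    simp only [waIter]
    rw [e1, hc x]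
    congr 1
    apply Finset.sum_congr rfl
    intro j _
    congr 1
    have e2 : waM (pderiv j (waShift h0 p)) (fun k i => (Fin.tail h k i : ℝ)) =
        waM (pderiv j (waDir h0 p)) (fun k i => (Fin.tail h k i : ℝ)) := by
      apply waM_congr
      intro m hm
      rw [coeff_pderiv, coeff_pderiv]
      congr 1
      by_contra hne
      have := d2 (m + Finsupp.single j 1) (by rw [coeff_sub]; exact sub_ne_zero.mpr hne)
      rw [map_add, Finsupp.degree_single, hm] at this
      omega
    have e3 : (fun k i => (h k i : ℝ)) = (Fin.cons h0 (fun k i => (Fin.tail h k i : ℝ)) : Fin (r+1) → Fin n → ℝ) := by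
      ext k i
      refine Fin.cases ?_ (fun y => ?_) k <;> simp [h0, Fin.tail]
    rw [e2, e3, waM_cons]
    unfold waDir
    rw [map_sum]
    simp_rw [Derivation.map_smul]
    rw [waM_sum]
    simp_rw [wa_pderiv_comm j]

lemma eC_norm (t : ℝ) : ‖eC t‖ = 1 := by
  unfold eC
  have : 2 * (Real.pi : ℂ) * Complex.I * (t : ℂ) = ((2 * Real.pi * t : ℝ) : ℂ) * Complex.I := by
    push_cast; ring
  rw [this, Complex.norm_exp_ofReal_mul_I]

lemma eC_add (s t : ℝ) : eC (s + t) = eC s * eC t := by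
  unfold eC
  rw [← Complex.exp_add]
  push_cast
  ring_nf

lemma eC_conj (t : ℝ) : (starRingEnd ℂ) (eC t) = eC (-t) := by
  unfold eC
  rw [← Complex.exp_conj]
  congr 1
  simp [map_ofNat]

def waBox (n M : ℕ) : Finset (Fin n → ℤ) := Finset.Icc (fun _ => -(M:ℤ)) (fun _ => (M:ℤ))

lemma waBox_card (n M : ℕ) : (waBox n M).card = (2*M+1)^n := by
  unfold waBox
  rw [Pi.card_Icc]
  simp
  congr 1
  omega

lemma mem_waBox {n M : ℕ} {x : Fin n → ℤ} : x ∈ waBox n M ↔ ∀ i, |x i| ≤ M := by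
  unfold waBox
  simp [Finset.mem_Icc, Pi.le_def, abs_le, forall_and]

lemma waWeyl_step {n : ℕ} (ψ : (Fin n → ℤ) → ℝ) (lo hi : Fin n → ℤ) (M : ℕ)
    (hM : ∀ j, hi j - lo j ≤ M) :
    ‖∑ x ∈ Finset.Icc lo hi, eC (ψ x)‖^2 ≤
      ∑ h ∈ waBox n M, ‖∑ x ∈ Finset.Icc (lo ⊔ (lo - h)) (hi ⊓ (hi - h)), eC (ψ (x + h) - ψ x)‖ := by
  have e1 : (‖∑ x ∈ Finset.Icc lo hi, eC (ψ x)‖^2 : ℝ) =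
      ‖∑ x ∈ Finset.Icc lo hi, ∑ y ∈ Finset.Icc lo hi, eC (ψ y - ψ x)‖ := by
    have : ∑ x ∈ Finset.Icc lo hi, ∑ y ∈ Finset.Icc lo hi, eC (ψ y - ψ x) =
      (starRingEnd ℂ) (∑ x ∈ Finset.Icc lo hi, eC (ψ x)) * (∑ x ∈ Finset.Icc lo hi, eC (ψ x)) := by
      rw [map_sum, Finset.sum_mul_sum]
      refine Finset.sum_congr rfl fun x _ => Finset.sum_congr rfl fun y _ => ?_
      rw [eC_conj, ← eC_add]
      congr 1; ring
    rw [this, norm_mul, RCLike.norm_conj, sq]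
  have e2 : ∑ x ∈ Finset.Icc lo hi, ∑ y ∈ Finset.Icc lo hi, eC (ψ y - ψ x) =
      ∑ h ∈ waBox n M, ∑ x ∈ Finset.Icc (lo ⊔ (lo - h)) (hi ⊓ (hi - h)), eC (ψ (x + h) - ψ x) := by
    rw [Finset.sum_sigma', Finset.sum_sigma']
    refine Finset.sum_bij' (fun z _ => ⟨z.2 - z.1, z.1⟩) (fun z _ => ⟨z.2, z.2 + z.1⟩) ?_ ?_ ?_ ?_ ?_
    · rintro ⟨x, y⟩ hz
      simp only [Finset.mem_sigma, Finset.mem_Icc, Pi.le_def, mem_waBox, Pi.sup_apply, Pi.inf_apply,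
        Pi.sub_apply, sup_le_iff, le_inf_iff, abs_le] at hz ⊢
      obtain ⟨⟨h1, h2⟩, h3, h4⟩ := hz
      refine ⟨fun i => ⟨?_, ?_⟩, ⟨fun i => ?_, fun i => ?_⟩, ⟨fun i => ?_, fun i => ?_⟩⟩ <;>
        have := h1 i <;> have := h2 i <;> have := h3 i <;> have := h4 i <;> have := hM i <;>
        omega
    · rintro ⟨h, x⟩ hz
      simp only [Finset.mem_sigma, Finset.mem_Icc, Pi.le_def, mem_waBox, Pi.sup_apply, Pi.inf_apply,
        Pi.sub_apply, sup_le_iff, le_inf_iff, abs_le, Pi.add_apply] at hz ⊢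
      obtain ⟨h1, ⟨h2, h2'⟩, h3, h3'⟩ := hz
      refine ⟨⟨fun i => ?_, fun i => ?_⟩, fun i => ?_, fun i => ?_⟩ <;>
        have := h1 i <;> have := h2 i <;> have := h3 i <;> have := h2' i <;> have := h3' i <;> omega
    · rintro ⟨x, y⟩ _; simp
    · rintro ⟨x, y⟩ _; simp
    · rintro ⟨x, y⟩ _; simp
  rw [e1, e2]
  exact norm_sum_le _ _

lemma waWeyl {n : ℕ} (M : ℕ) (r : ℕ) : ∀ (ψ : (Fin n → ℤ) → ℝ) (lo hi : Fin n → ℤ)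
    (_ : ∀ j, hi j - lo j ≤ M) (Bd : (Fin r → Fin n → ℤ) → ℝ)
    (_ : ∀ h, ∀ lo' hi' : Fin n → ℤ, (∀ j, hi' j - lo' j ≤ M) →
      ‖∑ x ∈ Finset.Icc lo' hi', eC (waIter r h ψ x)‖ ≤ Bd h),
    ‖∑ x ∈ Finset.Icc lo hi, eC (ψ x)‖ ^ (2^r) ≤
      ((2*(M:ℝ)+1)^n)^(2^r - r - 1) * ∑ h ∈ Fintype.piFinset (fun _ : Fin r => waBox n M), Bd h := by
  induction r with
  | zero =>
    intro ψ lo hi hM Bd hBd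
    simp only [waIter] at hBd
    simp
    exact hBd _ lo hi hM
  | succ r ih =>
    intro ψ lo hi hM Bd hBd
    set S := ‖∑ x ∈ Finset.Icc lo hi, eC (ψ x)‖ with hS
    set Sh : (Fin n → ℤ) → ℝ := fun h =>
      ‖∑ x ∈ Finset.Icc (lo ⊔ (lo - h)) (hi ⊓ (hi - h)), eC (ψ (x + h) - ψ x)‖ with hSh
    have h1 : S^2 ≤ ∑ h ∈ waBox n M, Sh h := waWeyl_step ψ lo hi M hM
    have hr : r + 1 ≤ 2^r := Nat.lt_two_pow_self
    set H : ℝ := (2*(M:ℝ)+1)^n with hH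
    have hHpos : 0 < H := by positivity
    have hcard : ((waBox n M).card : ℝ) = H := by rw [waBox_card]; push_cast; rfl
    have h2 : (∑ h ∈ waBox n M, Sh h)^(2^r) ≤ H^(2^r-1) * ∑ h ∈ waBox n M, (Sh h)^(2^r) := by
      have := pow_sum_div_card_le_sum_pow (s := waBox n M) (f := Sh) (fun h _ => norm_nonneg _) (2^r-1)
      rw [hcard, div_le_iff₀ (by positivity), show 2^r - 1 + 1 = 2^r by omega] at this
      linarith
    have h3 : ∀ h ∈ waBox n M, (Sh h)^(2^r) ≤ H^(2^r - r - 1) *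
        ∑ h' ∈ Fintype.piFinset (fun _ : Fin r => waBox n M), Bd (Fin.cons h h' : Fin (r+1) → Fin n → ℤ) := by
      intro h _
      apply ih (fun x => ψ (x + h) - ψ x)
      · intro j
        have := hM j
        simp only [Pi.inf_apply, Pi.sup_apply, Pi.sub_apply]
        have a1 : hi j ⊓ (hi j - h j) ≤ hi j := inf_le_left
        have a2 : lo j ≤ lo j ⊔ (lo j - h j) := le_sup_left
        omega
      · intro h' lo' hi' hM'
        have := hBd (Fin.cons h h' : Fin (r+1) → Fin n → ℤ) lo' hi' hM'
        simpa [waIter] using this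
    have h4 : ∑ h ∈ Fintype.piFinset (fun _ : Fin (r+1) => waBox n M), Bd h =
        ∑ h ∈ waBox n M, ∑ h' ∈ Fintype.piFinset (fun _ : Fin r => waBox n M),
          Bd (Fin.cons h h' : Fin (r+1) → Fin n → ℤ) := by
      rw [← Finset.sum_product']
      symm
      refine Finset.sum_bij' (fun z _ => (Fin.cons z.1 z.2 : Fin (r+1) → Fin n → ℤ))
        (fun h _ => (h 0, Fin.tail h)) ?_ ?_ ?_ ?_ ?_
      · rintro ⟨a, b⟩ hab
        simp only [Finset.mem_product, Fintype.mem_piFinset] at hab ⊢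
        intro k
        refine Fin.cases ?_ (fun y => ?_) k
        · simpa using hab.1
        · simpa using hab.2 y
      · intro h hh
        simp only [Finset.mem_product, Fintype.mem_piFinset] at hh ⊢
        exact ⟨hh 0, fun y => hh _⟩
      · rintro ⟨a, b⟩ _; simp
      · intro h _; simp
      · rintro ⟨a, b⟩ _; simp
    calc S^(2^(r+1)) = (S^2)^(2^r) := by rw [← pow_mul, pow_succ, mul_comm]
      _ ≤ (∑ h ∈ waBox n M, Sh h)^(2^r) := by gcongr
      _ ≤ H^(2^r-1) * ∑ h ∈ waBox n M, (Sh h)^(2^r) := h2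
      _ ≤ H^(2^r-1) * ∑ h ∈ waBox n M, (H^(2^r - r - 1) *
        ∑ h' ∈ Fintype.piFinset (fun _ : Fin r => waBox n M), Bd (Fin.cons h h' : Fin (r+1) → Fin n → ℤ)) := by
          gcongr with h hh
          exact h3 h hh
      _ = _ := by
          rw [← Finset.mul_sum, ← h4, ← mul_assoc, ← pow_add]
          congr 2
          rw [pow_succ]
          omega

lemma wa_tele (f : ℤ → ℂ) (lo : ℤ) (N : ℕ) :
    ∑ x ∈ Finset.Ico lo (lo + N), (f (x+1) - f x) = f (lo + N) - f lo := by
  induction N with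
  | zero => simp
  | succ N ih =>
    have : Finset.Ico lo (lo + (N+1 : ℕ)) = insert (lo + N) (Finset.Ico lo (lo + N)) := by
      ext x; simp only [Finset.mem_Ico, Finset.mem_insert]; push_cast; omega
    rw [this, Finset.sum_insert (by simp), ih]
    push_cast
    ring_nf

lemma wa_geom_mul (l : ℝ) (lo hi : ℤ) :
    ‖eC l - 1‖ * ‖∑ x ∈ Finset.Icc lo hi, eC (l * x)‖ ≤ 2 := by
  rw [← norm_mul, Finset.mul_sum]
  have h1 : ∀ x ∈ Finset.Icc lo hi, (eC l - 1) * eC (l * x) = eC (l * ((x+1 : ℤ) : ℝ)) - eC (l * x) := by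
    intro x _
    rw [sub_mul, one_mul, ← eC_add]
    congr 2
    push_cast; ring
  rw [Finset.sum_congr rfl h1]
  by_cases h : lo ≤ hi + 1
  · have h2 : Finset.Icc lo hi = Finset.Ico lo (lo + ((hi + 1 - lo).toNat : ℕ)) := by
      ext x; simp only [Finset.mem_Icc, Finset.mem_Ico]; omega
    rw [h2, wa_tele (fun x => eC (l * (x : ℝ)))]
    refine (norm_sub_le _ _).trans ?_
    rw [eC_norm, eC_norm]; norm_num
  · rw [Finset.Icc_eq_empty (by omega)]
    simp

lemma wa_eC_sub_one (l : ℝ) : ‖eC l - 1‖ = 2 * Real.sin (Real.pi * Int.fract l) := by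
  have h1 : eC l = eC (Int.fract l) := by
    conv_lhs => rw [← Int.floor_add_fract l]
    rw [eC_add]
    have : eC (⌊l⌋ : ℝ) = 1 := by
      unfold eC
      rw [Complex.exp_eq_one_iff]
      exact ⟨⌊l⌋, by push_cast; ring⟩
    rw [this, one_mul]
  rw [h1]
  set t := Int.fract l
  have ht0 : 0 ≤ t := Int.fract_nonneg l
  have ht1 : t < 1 := Int.fract_lt_one l
  have h2 : eC t = Complex.exp (Complex.I * ((2 * Real.pi * t : ℝ) : ℂ)) := by
    unfold eC; congr 1; push_cast; ring
  rw [h2, Complex.norm_exp_I_mul_ofReal_sub_one]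
  rw [Real.norm_eq_abs, abs_mul, abs_of_nonneg (by norm_num : (0:ℝ) ≤ 2)]
  have : 2 * Real.pi * t / 2 = Real.pi * t := by ring
  rw [this, abs_of_nonneg]
  apply Real.sin_nonneg_of_nonneg_of_le_pi
  · positivity
  · nlinarith [Real.pi_pos]

lemma wa_sin_lower (t : ℝ) (h0 : 0 < t) (h1 : t < 1) :
    2 ≤ Real.sin (Real.pi * t) * (1/t + 1/(1-t)) := by
  have h1' : 0 < 1 - t := by linarith
  have hs : 0 ≤ Real.sin (Real.pi * t) := by
    apply Real.sin_nonneg_of_nonneg_of_le_pi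
    · positivity
    · nlinarith [Real.pi_pos]
  by_cases h : t ≤ 1/2
  · have := Real.mul_le_sin (x := Real.pi * t) (by positivity) (by nlinarith [Real.pi_pos])
    have e : 2 / Real.pi * (Real.pi * t) = 2 * t := by field_simp
    rw [e] at this
    calc (2:ℝ) = 2 * t * (1/t) := by field_simp
      _ ≤ Real.sin (Real.pi * t) * (1/t) := by gcongr
      _ ≤ _ := by gcongr; have : 0 < 1/(1-t) := by positivity
                  linarith
  · push Not at h
    have := Real.mul_le_sin (x := Real.pi * (1-t)) (by positivity) (by nlinarith [Real.pi_pos])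
    have e : 2 / Real.pi * (Real.pi * (1-t)) = 2 * (1-t) := by field_simp
    have e2 : Real.sin (Real.pi * (1-t)) = Real.sin (Real.pi * t) := by
      rw [mul_sub, mul_one, Real.sin_pi_sub]
    rw [e, e2] at this
    calc (2:ℝ) = 2 * (1-t) * (1/(1-t)) := by field_simp
      _ ≤ Real.sin (Real.pi * t) * (1/(1-t)) := by gcongr
      _ ≤ _ := by gcongr; have : 0 < 1/t := by positivity
                  linarith

def waW (Q r : ℕ) : ℝ := 2 * Q * (1 / ((r:ℝ) + 1) + 1 / ((Q:ℝ) - r))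

def waCell (Q : ℕ) (l : ℝ) : ℕ := ⌊Q * Int.fract l⌋₊

lemma waCell_lt (Q : ℕ) (hQ : 0 < Q) (l : ℝ) : waCell Q l < Q := by
  unfold waCell
  rw [Nat.floor_lt (by have := Int.fract_nonneg l; positivity)]
  have := Int.fract_lt_one l
  have : (0:ℝ) < Q := by exact_mod_cast hQ
  nlinarith

lemma wa_geom (l : ℝ) (lo hi : ℤ) (M Q : ℕ) (hM : hi - lo ≤ M) (hQ : M + 1 ≤ Q) :
    ‖∑ x ∈ Finset.Icc lo hi, eC (l * x)‖ ≤ waW Q (waCell Q l) := by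
  have hQ0 : 0 < Q := by omega
  have hr := waCell_lt Q hQ0 l
  set r := waCell Q l with hrdef
  have hQR : (0:ℝ) < Q := by exact_mod_cast hQ0
  have hrR : (0:ℝ) < (Q:ℝ) - r := by
    have : (r:ℝ) < Q := by exact_mod_cast hr
    linarith
  have triv : ‖∑ x ∈ Finset.Icc lo hi, eC (l * x)‖ ≤ Q := by
    refine (norm_sum_le _ _).trans ?_
    simp only [eC_norm]
    rw [Finset.sum_const, nsmul_eq_mul, mul_one, Int.card_Icc]
    exact_mod_cast (show (hi + 1 - lo).toNat ≤ Q by omega)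
  unfold waW
  have hp1 : 0 < 1 / ((r:ℝ) + 1) := by positivity
  have hp2 : 0 < 1 / ((Q:ℝ) - r) := by positivity
  by_cases h0 : r = 0
  · refine triv.trans ?_
    rw [h0] at hp2 ⊢
    simp only [Nat.cast_zero, zero_add, div_one] at hp2 ⊢
    nlinarith
  by_cases h1 : r + 1 = Q
  · refine triv.trans ?_
    have : (Q:ℝ) - r = 1 := by rw [← h1]; push_cast; ring
    rw [this]
    simp only [div_one]
    nlinarith
  have hr1 : (1:ℝ) ≤ r := by exact_mod_cast Nat.one_le_iff_ne_zero.mpr h0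
  have hr2 : (r:ℝ) + 2 ≤ Q := by exact_mod_cast (show r + 2 ≤ Q by omega)
  set t := Int.fract l with ht
  have ht0 : 0 ≤ t := Int.fract_nonneg l
  have f1 : (r:ℝ) ≤ Q * t := Nat.floor_le (by positivity)
  have f2 : Q * t < r + 1 := Nat.lt_floor_add_one _
  have t0 : 0 < t := by
    by_contra h
    have : t = 0 := le_antisymm (not_lt.mp h) ht0
    rw [this] at f1; linarith
  have t1 : t < 1 := Int.fract_lt_one l
  have t1' : 0 < 1 - t := by linarith
  have hmul := wa_geom_mul l lo hi
  rw [wa_eC_sub_one] at hmul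
  have hsin := wa_sin_lower t t0 t1
  set S := ‖∑ x ∈ Finset.Icc lo hi, eC (l * x)‖ with hS
  have hS0 : 0 ≤ S := norm_nonneg _
  have g1 : 2 * S ≤ 1/t + 1/(1-t) := by
    have hpos : 0 < 1/t + 1/(1-t) := by positivity
    nlinarith [mul_le_mul_of_nonneg_right hsin hS0, mul_le_mul_of_nonneg_right hmul hpos.le]
  have g2 : 1/t ≤ 2 * Q * (1/((r:ℝ)+1)) := by
    rw [mul_one_div, div_le_div_iff₀ t0 (by positivity)]
    nlinarith
  have g3 : 1/(1-t) ≤ 2 * Q * (1/((Q:ℝ)-r)) := by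
    rw [mul_one_div, div_le_div_iff₀ t1' hrR]
    nlinarith
  have : 0 ≤ 2 * (Q:ℝ) * (1/((r:ℝ)+1) + 1/((Q:ℝ)-r)) := by positivity
  nlinarith

lemma waW_sum (Q : ℕ) : ∑ r ∈ Finset.range Q, waW Q r ≤ 4 * Q * (1 + Real.log Q) := by
  unfold waW
  rw [← Finset.mul_sum, Finset.sum_add_distrib]
  have h1 : ∑ r ∈ Finset.range Q, 1 / ((r:ℝ) + 1) = ((harmonic Q : ℚ) : ℝ) := by
    unfold harmonic
    push_cast
    simp
  have h2 : ∑ r ∈ Finset.range Q, 1 / ((Q:ℝ) - r) = ((harmonic Q : ℚ) : ℝ) := by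
    rw [← h1, ← Finset.sum_range_reflect]
    apply Finset.sum_congr rfl
    intro r hr
    have : r < Q := Finset.mem_range.mp hr
    rw [show Q - 1 - r = Q - (r + 1) by omega, Nat.cast_sub (by omega)]
    push_cast
    congr 1; ring
  rw [h1, h2]
  have := harmonic_le_one_add_log Q
  have hQ : (0:ℝ) ≤ Q := by positivity
  nlinarith

lemma waW_nonneg {Q r : ℕ} (h : r < Q) : 0 ≤ waW Q r := by
  unfold waW
  have : (r:ℝ) < Q := by exact_mod_cast h
  have : 0 < (Q:ℝ) - r := by linarith
  positivity

lemma wa_linear_sum {n : ℕ} (c : ℝ) (l : Fin n → ℝ) (lo hi : Fin n → ℤ) (M Q : ℕ)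
    (hM : ∀ j, hi j - lo j ≤ M) (hQ : M + 1 ≤ Q) :
    ‖∑ x ∈ Finset.Icc lo hi, eC (c + ∑ j, (x j : ℝ) * l j)‖ ≤ ∏ j, waW Q (waCell Q (l j)) := by
  have hsumC : ∀ (s : Finset (Fin n)) (g : Fin n → ℝ), eC (∑ j ∈ s, g j) = ∏ j ∈ s, eC (g j) := by
    classical
    intro s g
    induction s using Finset.induction_on with
    | empty => simp [eC]
    | insert a s ha ih => rw [Finset.sum_insert ha, Finset.prod_insert ha, eC_add, ih]
  have h1 : ∑ x ∈ Finset.Icc lo hi, eC (c + ∑ j, (x j : ℝ) * l j) =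
      eC c * ∏ j, ∑ x ∈ Finset.Icc (lo j) (hi j), eC (l j * x) := by
    rw [Finset.prod_univ_sum, Finset.mul_sum]
    have : Finset.Icc lo hi = Fintype.piFinset (fun j => Finset.Icc (lo j) (hi j)) := by
      ext x; simp [Finset.mem_Icc, Pi.le_def, forall_and]
    rw [this]
    apply Finset.sum_congr rfl
    intro x _
    rw [eC_add, hsumC]
    simp_rw [mul_comm]
  rw [h1, norm_mul, eC_norm, one_mul, norm_prod]
  exact Finset.prod_le_prod (fun _ _ => norm_nonneg _) (fun j _ => wa_geom _ _ _ M Q (hM j) hQ)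

lemma wa_cells {n : ℕ} (L : Fin n → Fin n → ℝ) (M Q : ℕ) (hQ : 0 < Q)
    (V : Finset (Fin n → ℤ))
    (hV : ∀ u : Fin n → ℤ, (∀ i, |(u i : ℝ)| ≤ 2 * M) →
      (∀ j, ∃ v : ℤ, |(∑ a, (u a : ℝ) * L j a) - v| ≤ 1 / Q) → u ∈ V) :
    ∑ u ∈ waBox n M, ∏ j, waW Q (waCell Q (∑ a, (u a : ℝ) * L j a)) ≤
      (∑ r ∈ Finset.range Q, waW Q r)^n * V.card := by
  classical
  have hQR : (0:ℝ) < Q := by exact_mod_cast hQ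
  set cell : (Fin n → ℤ) → (Fin n → ℕ) := fun u j => waCell Q (∑ a, (u a : ℝ) * L j a) with hcell
  have hmaps : ∀ u ∈ waBox n M, cell u ∈ Fintype.piFinset (fun _ : Fin n => Finset.range Q) := by
    intro u _
    simp only [Fintype.mem_piFinset, Finset.mem_range]
    exact fun j => waCell_lt Q hQ _
  rw [← Finset.sum_fiberwise_of_maps_to hmaps]
  have key : ∀ ρ ∈ Fintype.piFinset (fun _ : Fin n => Finset.range Q),
      ∑ u ∈ waBox n M with cell u = ρ, ∏ j, waW Q (waCell Q (∑ a, (u a : ℝ) * L j a)) ≤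
      (∏ j, waW Q (ρ j)) * V.card := by
    intro ρ hρ
    have hρ' : ∀ j, ρ j < Q := by simpa using hρ
    have e : ∀ u ∈ (waBox n M).filter (fun u => cell u = ρ),
        ∏ j, waW Q (waCell Q (∑ a, (u a : ℝ) * L j a)) = ∏ j, waW Q (ρ j) := by
      intro u hu
      have := (Finset.mem_filter.mp hu).2
      rw [← this]
    rw [Finset.sum_congr rfl e, Finset.sum_const, nsmul_eq_mul, mul_comm]
    apply mul_le_mul_of_nonneg_left _ (Finset.prod_nonneg fun j _ => waW_nonneg (hρ' j))
    norm_cast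
    rcases Finset.eq_empty_or_nonempty ((waBox n M).filter (fun u => cell u = ρ)) with h | ⟨u0, hu0⟩
    · rw [h]; simp
    · apply Finset.card_le_card_of_injOn (fun u => u - u0)
      · intro u hu
        simp only [Finset.coe_filter, Set.mem_setOf_eq] at hu
        obtain ⟨hu1, hu2⟩ := hu
        obtain ⟨hv1, hv2⟩ := Finset.mem_filter.mp hu0
        rw [mem_waBox] at hu1 hv1
        apply hV
        · intro i
          have a1 := hu1 i
          have a2 := hv1 i
          have a3 : |(u - u0) i| ≤ 2 * M := by
            rw [Pi.sub_apply]; exact (abs_sub _ _).trans (by omega)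
          exact_mod_cast a3
        · intro j
          set x := ∑ a, (u a : ℝ) * L j a with hx
          set y := ∑ a, (u0 a : ℝ) * L j a with hy
          have e1 : ∑ a, (((u - u0) a : ℤ) : ℝ) * L j a = x - y := by
            rw [hx, hy, ← Finset.sum_sub_distrib]
            apply Finset.sum_congr rfl
            intro a _
            push_cast [Pi.sub_apply]; ring
          refine ⟨⌊x⌋ - ⌊y⌋, ?_⟩
          rw [e1]
          have hxy : waCell Q x = waCell Q y := by
            have b1 := congrFun hu2 j
            have b2 := congrFun hv2 j
            simp only [hcell] at b1 b2
            rw [hx, hy, b1, b2]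
          have e2 : x - y - ((⌊x⌋ - ⌊y⌋ : ℤ) : ℝ) = Int.fract x - Int.fract y := by
            push_cast [Int.fract]; ring
          rw [e2]
          unfold waCell at hxy
          have fx := Int.fract_nonneg x
          have fy := Int.fract_nonneg y
          have x1 : (⌊Q * Int.fract x⌋₊ : ℝ) ≤ Q * Int.fract x := Nat.floor_le (by positivity)
          have x2 : Q * Int.fract x < ⌊Q * Int.fract x⌋₊ + 1 := Nat.lt_floor_add_one _
          have y1 : (⌊Q * Int.fract y⌋₊ : ℝ) ≤ Q * Int.fract y := Nat.floor_le (by positivity)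
          have y2 : Q * Int.fract y < ⌊Q * Int.fract y⌋₊ + 1 := Nat.lt_floor_add_one _
          rw [hxy] at x1 x2
          rw [le_div_iff₀ hQR, show ∀ z : ℝ, |z| * Q = |z * Q| from fun z => by rw [abs_mul, abs_of_pos hQR], abs_le]
          constructor <;> nlinarith
      · intro a _ b _ hab
        simpa using hab
  refine (Finset.sum_le_sum key).trans ?_
  rw [← Finset.sum_mul]
  have : (∑ r ∈ Finset.range Q, waW Q r)^n = ∑ ρ ∈ Fintype.piFinset (fun _ : Fin n => Finset.range Q), ∏ j, waW Q (ρ j) := by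
    rw [Finset.sum_pow']
    
  rw [this]

lemma waFiber {X : Type*} [DecidableEq X] {r : ℕ} (k : Fin r) (x0 : X) (A B : Finset (Fin r → X))
    (w : (Fin r → X) → ℝ) (C : ℝ) (hC : 0 ≤ C)
    (hyp : ∀ h0 ∈ A, ∀ U V : Finset X, (∀ u, u ∈ U ↔ Function.update h0 k u ∈ A) →
      (∀ u, u ∈ V ↔ Function.update h0 k u ∈ B) →
      ∑ u ∈ U, w (Function.update h0 k u) ≤ C * V.card) :
    ∑ h ∈ A, w h ≤ C * B.card := by
  set π : (Fin r → X) → (Fin r → X) := fun h => Function.update h k x0 with hπ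
  have hinv : ∀ h h0 : Fin r → X, π h = π h0 → Function.update h0 k (h k) = h := by
    intro h h0 hh
    ext x
    by_cases hx : x = k
    · subst hx; simp
    · have := congrFun hh x
      simp [hπ, hx] at this
      simp [hx, this]
  have hfib : ∀ h0 : Fin r → X, ∀ D : Finset (Fin r → X), ∀ u, 
      u ∈ (D.filter (fun h => π h = π h0)).image (fun h => h k) ↔ Function.update h0 k u ∈ D := by
    intro h0 D u
    simp only [Finset.mem_image, Finset.mem_filter]
    constructor
    · rintro ⟨h, ⟨h1, h2⟩, rfl⟩
      rwa [hinv h h0 h2]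
    · intro h
      exact ⟨_, ⟨h, by simp [hπ]⟩, by simp⟩
  have hinj : ∀ h0 : Fin r → X, ∀ D : Finset (Fin r → X), 
      Set.InjOn (fun h : Fin r → X => h k) (D.filter (fun h => π h = π h0)) := by
    intro h0 D a ha b hb hab
    simp only [Finset.coe_filter, Set.mem_setOf_eq] at ha hb
    rw [← hinv a h0 ha.2, ← hinv b h0 hb.2]
    simp only at hab
    rw [hab]
  rw [← Finset.sum_fiberwise_of_maps_to (s := A) (t := A.image π) (g := π)
    (fun h hh => Finset.mem_image_of_mem _ hh)]
  have key : ∀ g ∈ A.image π, ∑ h ∈ A with π h = g, w h ≤ C * ((B.filter (fun h => π h = g)).card : ℝ) := by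
    intro g hg
    obtain ⟨h0, hh0, rfl⟩ := Finset.mem_image.mp hg
    have := hyp h0 hh0 _ _ (hfib h0 A) (hfib h0 B)
    rw [Finset.sum_image (hinj h0 A), Finset.card_image_of_injOn (hinj h0 B)] at this
    refine le_trans (le_of_eq ?_) this
    apply Finset.sum_congr rfl
    intro h hh
    rw [hinv h h0 (Finset.mem_filter.mp hh).2]
  refine (Finset.sum_le_sum key).trans ?_
  rw [← Finset.mul_sum]
  apply mul_le_mul_of_nonneg_left _ hC
  norm_cast
  rw [← Finset.card_biUnion]
  · apply Finset.card_le_card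
    intro h hh
    simp only [Finset.mem_biUnion, Finset.mem_filter] at hh
    obtain ⟨_, _, h1, _⟩ := hh
    exact h1
  · intro a _ b _ hab
    rw [Function.onFun, Finset.disjoint_left]
    intro h h1 h2
    exact hab ((Finset.mem_filter.mp h1).2.symm.trans (Finset.mem_filter.mp h2).2)

lemma wa_packing {E : Type*} [NormedAddCommGroup E] [NormedSpace ℝ E] [FiniteDimensional ℝ E]
    (t : ℝ) (ht : 0 < t) (ht1 : t ≤ 1) (s : Finset E) (hs : ∀ c ∈ s, ‖c‖ ≤ 1)
    (h : ∀ c ∈ s, ∀ d ∈ s, c ≠ d → t ≤ ‖c - d‖) :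
    (s.card : ℝ) ≤ (3 / t) ^ Module.finrank ℝ E := by
  borelize E
  let μ : Measure E := Measure.addHaar
  have hδ : 0 < t / 2 := by positivity
  have hρ : (0:ℝ) < 3 / 2 := by norm_num
  set A := ⋃ c ∈ s, Metric.ball (c : E) (t/2) with hA
  have D : Set.Pairwise (s : Set E) (Function.onFun Disjoint fun c => Metric.ball (c : E) (t/2)) := by
    rintro c hc d hd hcd
    apply Metric.ball_disjoint_ball
    rw [dist_eq_norm]
    have := h c hc d hd hcd
    linarith
  have A_subset : A ⊆ Metric.ball (0 : E) (3/2) := by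
    refine Set.iUnion₂_subset fun x hx => ?_
    apply Metric.ball_subset_ball'
    rw [dist_zero_right]
    have := hs x hx
    linarith
  have I : (s.card : ENNReal) * ENNReal.ofReal ((t/2) ^ Module.finrank ℝ E) * μ (Metric.ball 0 1) ≤
      ENNReal.ofReal ((3/2) ^ Module.finrank ℝ E) * μ (Metric.ball 0 1) :=
    calc
      _ = μ A := by
        rw [hA, measure_biUnion_finset D fun c _ => measurableSet_ball]
        simp only [μ.addHaar_ball_of_pos _ hδ]
        simp only [Finset.sum_const, nsmul_eq_mul, mul_assoc]
      _ ≤ μ (Metric.ball (0 : E) (3/2)) := measure_mono A_subset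
      _ = _ := by
        simp only [μ.addHaar_ball_of_pos _ hρ]
  have J : (s.card : ENNReal) * ENNReal.ofReal ((t/2) ^ Module.finrank ℝ E) ≤
      ENNReal.ofReal ((3/2) ^ Module.finrank ℝ E) :=
    (ENNReal.mul_le_mul_iff_left (Metric.measure_ball_pos _ _ zero_lt_one).ne' measure_ball_lt_top.ne).1 I
  have K := ENNReal.toReal_le_of_le_ofReal (pow_nonneg hρ.le _) J
  rw [ENNReal.toReal_mul, ENNReal.toReal_natCast, ENNReal.toReal_ofReal (by positivity)] at K
  rw [show (3 / t : ℝ) = (3/2) / (t/2) by field_simp, div_pow, le_div_iff₀ (by positivity)]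
  exact K

def waSymp (n : ℕ) : LinearMap.BilinForm ℝ ((Fin n → ℝ) × (Fin n → ℝ)) :=
  LinearMap.mk₂ ℝ (fun a b => ∑ j, (a.1 j * b.2 j - a.2 j * b.1 j))
    (by intros; simp only [Prod.fst_add, Prod.snd_add, Pi.add_apply]
        rw [← Finset.sum_add_distrib]; apply Finset.sum_congr rfl; intros; ring)
    (by intros; simp only [Prod.smul_fst, Prod.smul_snd, Pi.smul_apply, smul_eq_mul, Finset.mul_sum]
        apply Finset.sum_congr rfl; intros; ring)
    (by intros; simp only [Prod.fst_add, Prod.snd_add, Pi.add_apply]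
        rw [← Finset.sum_add_distrib]; apply Finset.sum_congr rfl; intros; ring)
    (by intros; simp only [Prod.smul_fst, Prod.smul_snd, Pi.smul_apply, smul_eq_mul, Finset.mul_sum]
        apply Finset.sum_congr rfl; intros; ring)

lemma waSymp_apply {n : ℕ} (a b : (Fin n → ℝ) × (Fin n → ℝ)) :
    waSymp n a b = ∑ j, (a.1 j * b.2 j - a.2 j * b.1 j) := rfl

lemma waSymp_ker (n : ℕ) : (waSymp n).ker = ⊥ := by
  rw [eq_bot_iff]
  intro a ha
  rw [LinearMap.mem_ker] at ha
  have h : ∀ b, waSymp n a b = 0 := fun b => by rw [ha]; rfl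
  simp only [waSymp_apply] at h
  have e1 : a.1 = 0 := by
    ext j
    have := h (0, Pi.single j 1)
    simpa [Pi.single_apply] using this
  have e2 : a.2 = 0 := by
    ext j
    have := h (Pi.single j 1, 0)
    simpa [Pi.single_apply] using this
  exact Prod.ext e1 e2

lemma wa_isotropic {n : ℕ} (T : Set ((Fin n → ℝ) × (Fin n → ℝ)))
    (hT : ∀ a ∈ T, ∀ b ∈ T, waSymp n a b = 0) :
    Module.finrank ℝ (Submodule.span ℝ T) ≤ n := by
  have h1 : Submodule.span ℝ T ≤ (waSymp n).orthogonal (Submodule.span ℝ T) := by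
    intro a ha
    rw [LinearMap.BilinForm.mem_orthogonal_iff]
    intro b hb
    change waSymp n b a = 0
    induction hb using Submodule.span_induction with
    | zero => simp
    | add x y _ _ hx hy => simp [hx, hy]
    | smul c x _ hx => simp [hx]
    | mem x hx =>
      induction ha using Submodule.span_induction with
      | zero => simp
      | add x y _ _ hx hy => simp [hx, hy]
      | smul c x _ hx => simp [hx]
      | mem y hy => exact hT x hx y hy
  have h2 := LinearMap.BilinForm.finrank_add_finrank_orthogonal' (B := waSymp n) (Submodule.span ℝ T)
  rw [waSymp_ker, inf_bot_eq, finrank_bot, add_zero] at h2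
  have h3 := Submodule.finrank_mono h1
  have h4 : Module.finrank ℝ ((Fin n → ℝ) × (Fin n → ℝ)) = n + n := by simp
  omega

lemma wa_shrink {n : ℕ} (L : Fin n → Fin n → ℝ) (hL : ∀ i j, L i j = L j i) (H δ t : ℝ)
    (hH : 0 < H) (hδ : 0 < δ) (hHδ : 2 * n * H * δ < 1) (ht : 0 < t) (ht1 : t ≤ 1)
    (U V : Finset (Fin n → ℤ))
    (hU : ∀ u ∈ U, (∀ i, |(u i : ℝ)| ≤ H) ∧ ∀ j, ∃ v : ℤ, |(∑ a, (u a : ℝ) * L j a) - v| ≤ δ)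
    (hV : ∀ u : Fin n → ℤ, (∀ i, |(u i : ℝ)| ≤ t * H) →
      (∀ j, ∃ v : ℤ, |(∑ a, (u a : ℝ) * L j a) - v| ≤ t * δ) → u ∈ V) :
    (U.card : ℝ) ≤ (3 / t) ^ n * V.card := by
  classical
  set v : (Fin n → ℤ) → Fin n → ℤ := fun u j => round (∑ a, (u a : ℝ) * L j a) with hv
  set φ : (Fin n → ℤ) → (Fin n → ℝ) × (Fin n → ℝ) := fun u =>
    (fun i => (u i : ℝ) / H, fun j => ((∑ a, (u a : ℝ) * L j a) - v u j) / δ) with hφ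
  have hφ1 : ∀ u ∈ U, ∀ i, |(φ u).1 i| ≤ 1 := by
    intro u hu i
    simp only [hφ, abs_div, abs_of_pos hH]
    rw [div_le_one hH]
    exact (hU u hu).1 i
  have hφ2 : ∀ u ∈ U, ∀ i, |(φ u).2 i| ≤ 1 := by
    intro u hu i
    simp only [hφ, abs_div, abs_of_pos hδ]
    rw [div_le_one hδ]
    obtain ⟨w, hw⟩ := (hU u hu).2 i
    exact (round_le _ w).trans hw
  have hnorm : ∀ u ∈ U, ‖φ u‖ ≤ 1 := by
    intro u hu
    rw [Prod.norm_def]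
    apply max_le
    · rw [pi_norm_le_iff_of_nonneg zero_le_one]; exact hφ1 u hu
    · rw [pi_norm_le_iff_of_nonneg zero_le_one]; exact hφ2 u hu
  have hsymp : ∀ a ∈ U, ∀ b ∈ U, waSymp n (φ a) (φ b) = 0 := by
    intro a ha b hb
    have e1 : waSymp n (φ a) (φ b) * (H * δ) = ((∑ j, (v a j * b j - a j * v b j) : ℤ) : ℝ) := by
      rw [waSymp_apply]
      have : ∀ j, ((φ a).1 j * (φ b).2 j - (φ a).2 j * (φ b).1 j) * (H*δ) =
          (a j : ℝ) * (∑ c, (b c : ℝ) * L j c) - (∑ c, (a c : ℝ) * L j c) * b j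
            + ((v a j : ℝ) * b j - a j * v b j) := by
        intro j
        simp only [hφ]
        field_simp
        ring
      rw [Finset.sum_mul, Finset.sum_congr rfl (fun j _ => this j), Finset.sum_add_distrib,
        Finset.sum_sub_distrib]
      have e2 : ∑ j, (a j : ℝ) * (∑ c, (b c : ℝ) * L j c) = ∑ j, (∑ c, (a c : ℝ) * L j c) * b j := by
        simp_rw [Finset.mul_sum, Finset.sum_mul]
        rw [Finset.sum_comm]
        apply Finset.sum_congr rfl; intro i _
        apply Finset.sum_congr rfl; intro j _
        rw [hL i j]; ring
      rw [e2, sub_self, zero_add]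
      push_cast; rfl
    have e2 : |waSymp n (φ a) (φ b)| ≤ 2 * n := by
      rw [waSymp_apply]
      refine (Finset.abs_sum_le_sum_abs _ _).trans ?_
      have : ∀ j ∈ Finset.univ, |(φ a).1 j * (φ b).2 j - (φ a).2 j * (φ b).1 j| ≤ 2 := by
        intro j _
        refine (abs_sub _ _).trans ?_
        rw [abs_mul, abs_mul]
        have a1 := hφ1 a ha j
        have a2 := hφ2 a ha j
        have b1 := hφ1 b hb j
        have b2 := hφ2 b hb j
        have c1 := mul_le_mul a1 b2 (abs_nonneg _) zero_le_one
        have c2 := mul_le_mul a2 b1 (abs_nonneg _) zero_le_one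
        linarith
      refine (Finset.sum_le_sum this).trans ?_
      simp [mul_comm]
    have e3 : |((∑ j, (v a j * b j - a j * v b j) : ℤ) : ℝ)| < 1 := by
      rw [← e1, abs_mul, abs_of_pos (mul_pos hH hδ)]
      calc _ ≤ 2 * n * (H * δ) := by gcongr
        _ < 1 := by linarith
    have e4 : (∑ j, (v a j * b j - a j * v b j) : ℤ) = 0 := by
      rw [← Int.abs_lt_one_iff]; exact_mod_cast e3
    rw [e4, Int.cast_zero] at e1
    rcases mul_eq_zero.mp e1 with h | h
    · exact h
    · have := mul_pos hH hδ; linarith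
  -- maximal separated set
  obtain ⟨Pr, hPr⟩ : ∃ Pr : Finset (Fin n → ℤ) → Prop, ∀ S, Pr S ↔ ∀ a ∈ S, ∀ b ∈ S, a ≠ b → t < ‖φ a - φ b‖ :=
    ⟨_, fun _ => Iff.rfl⟩
  set F := U.powerset.filter Pr with hF
  have hFne : F.Nonempty := ⟨∅, by simp [hF, hPr]⟩
  obtain ⟨S, hS, hmax⟩ := Finset.exists_max_image F Finset.card hFne
  rw [hF, Finset.mem_filter, Finset.mem_powerset, hPr] at hS
  obtain ⟨hSU, hsep⟩ := hS
  have hcov : ∀ u ∈ U, ∃ s ∈ S, ‖φ u - φ s‖ ≤ t := by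
    intro u hu
    by_contra hcon
    push Not at hcon
    have huS : u ∉ S := by
      intro h; have := hcon u h; simp at this; linarith
    have : insert u S ∈ F := by
      rw [hF, Finset.mem_filter, Finset.mem_powerset, hPr]
      refine ⟨Finset.insert_subset hu hSU, ?_⟩
      intro a ha b hb hab
      rw [Finset.mem_insert] at ha hb
      rcases ha with rfl | ha <;> rcases hb with rfl | hb
      · exact absurd rfl hab
      · exact hcon _ hb
      · rw [norm_sub_rev]; exact hcon _ ha
      · exact hsep a ha b hb hab
    have := hmax _ this
    rw [Finset.card_insert_of_notMem huS] at this
    omega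
  have hScard : (S.card : ℝ) ≤ (3 / t)^n := by
    set W := Submodule.span ℝ (φ '' (U : Set (Fin n → ℤ)))
    have hW : Module.finrank ℝ W ≤ n := by
      apply wa_isotropic
      rintro _ ⟨a, ha, rfl⟩ _ ⟨b, hb, rfl⟩
      exact hsymp a ha b hb
    have hmem : ∀ u : S, φ u ∈ W := fun u => Submodule.subset_span ⟨u, hSU u.2, rfl⟩
    set ψ : S → W := fun u => ⟨φ u, hmem u⟩ with hψ
    have hψinj : Function.Injective ψ := by
      intro a b hab
      by_contra hne
      have h1 := hsep a a.2 b b.2 (fun h => hne (Subtype.ext h))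
      have h2 : φ a = φ b := congrArg Subtype.val hab
      rw [h2, sub_self, norm_zero] at h1
      linarith
    have := wa_packing t ht ht1 (Finset.univ.image ψ) (by
      intro c hc
      obtain ⟨u, _, rfl⟩ := Finset.mem_image.mp hc
      exact hnorm u (hSU u.2)) (by
      intro c hc d hd hcd
      obtain ⟨u, _, rfl⟩ := Finset.mem_image.mp hc
      obtain ⟨w, _, rfl⟩ := Finset.mem_image.mp hd
      have : (u : Fin n → ℤ) ≠ w := fun h => hcd (by rw [Subtype.ext h])
      exact (hsep u u.2 w w.2 this).le)
    rw [Finset.card_image_of_injective _ hψinj, Finset.card_univ, Fintype.card_coe] at this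
    refine this.trans ?_
    apply pow_le_pow_right₀ _ hW
    rw [le_div_iff₀ ht]; linarith
  have hUc : U.card ≤ S.card * V.card := by
    choose! s hs using hcov
    refine Finset.card_le_mul_card_image_of_maps_to (f := s) (t := S) (fun u hu => (hs u hu).1) V.card ?_ |>.trans (by rw [mul_comm])
    intro c hc
    apply Finset.card_le_card_of_injOn (fun u => u - c)
    · intro u hu
      simp only [Finset.coe_filter, Set.mem_setOf_eq] at hu
      obtain ⟨hu1, rfl⟩ := hu
      have hb := (hs u hu1).2
      rw [Prod.norm_def] at hb
      have hb1 := (le_max_left _ _).trans hb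
      have hb2 := (le_max_right _ _).trans hb
      rw [pi_norm_le_iff_of_nonneg ht.le] at hb1 hb2
      simp only [Finset.mem_coe]
      apply hV
      · intro i
        have := hb1 i
        simp only [hφ, Prod.fst_sub, Pi.sub_apply, Real.norm_eq_abs] at this
        rw [← sub_div, abs_div, abs_of_pos hH, div_le_iff₀ hH] at this
        push_cast [Pi.sub_apply]; exact this
      · intro j
        refine ⟨v u j - v (s u) j, ?_⟩
        have := hb2 j
        simp only [hφ, Prod.snd_sub, Pi.sub_apply, Real.norm_eq_abs] at this
        rw [← sub_div, abs_div, abs_of_pos hδ, div_le_iff₀ hδ] at this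
        refine le_trans (le_of_eq ?_) this
        congr 1
        push_cast [Pi.sub_apply]
        simp_rw [sub_mul]
        rw [Finset.sum_sub_distrib]; ring
    · intro a _ b _ hab
      simpa using hab
  calc (U.card : ℝ) ≤ S.card * V.card := by exact_mod_cast hUc
    _ ≤ _ := by gcongr

open Classical in
def waCnt {n r : ℕ} (p : MvPolynomial (Fin n) ℝ) (H : Fin r → ℝ) (δ : ℝ) :
    Finset (Fin r → Fin n → ℤ) :=
  (Fintype.piFinset fun k => waBox n ⌊H k⌋₊).filter
    (fun h => ∀ j, ∃ v : ℤ, |waM (pderiv j p) (fun k i => (h k i : ℝ)) - v| ≤ δ)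

lemma wa_floor_abs (x : ℤ) (H : ℝ) (hH : 0 ≤ H) : |x| ≤ (⌊H⌋₊ : ℤ) ↔ |(x : ℝ)| ≤ H := by
  rw [← Int.cast_abs, ← Int.natCast_natAbs, Nat.cast_le, Nat.le_floor_iff hH]
  simp

lemma mem_waCnt {n r : ℕ} {p : MvPolynomial (Fin n) ℝ} {H : Fin r → ℝ} {δ : ℝ}
    (hH : ∀ k, 0 ≤ H k) {h : Fin r → Fin n → ℤ} :
    h ∈ waCnt p H δ ↔ (∀ k i, |(h k i : ℝ)| ≤ H k) ∧
      ∀ j, ∃ v : ℤ, |waM (pderiv j p) (fun k i => (h k i : ℝ)) - v| ≤ δ := by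
  classical
  unfold waCnt
  rw [Finset.mem_filter, Fintype.mem_piFinset]
  simp only [mem_waBox, wa_floor_abs _ _ (hH _)]

lemma wa_cast_update {n r : ℕ} (h : Fin r → Fin n → ℤ) (k : Fin r) (u : Fin n → ℤ) :
    (fun k' i => ((Function.update h k u k' i : ℤ) : ℝ)) =
      Function.update (fun k' i => (h k' i : ℝ)) k (fun i => (u i : ℝ)) := by
  ext k' i
  by_cases hk : k' = k
  · subst hk; simp
  · simp [hk]

lemma wa_lin {n r : ℕ} (p : MvPolynomial (Fin n) ℝ) (h : Fin r → Fin n → ℤ) (k : Fin r)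
    (u : Fin n → ℤ) (j : Fin n) :
    waM (pderiv j p) (fun k' i => ((Function.update h k u k' i : ℤ) : ℝ)) =
    ∑ a, (u a : ℝ) * waM (pderiv j p) (Function.update (fun k' i => (h k' i : ℝ)) k (Pi.single a 1)) := by
  rw [wa_cast_update, waM_update]

lemma waCnt_step {n r : ℕ} (p : MvPolynomial (Fin n) ℝ) (H : Fin r → ℝ) (δ t : ℝ)
    (hH : ∀ k, 0 < H k) (hδ : 0 < δ) (k : Fin r) (hHδ : 2 * n * H k * δ < 1)
    (ht : 0 < t) (ht1 : t ≤ 1) :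
    ((waCnt p H δ).card : ℝ) ≤ (3 / t)^n * (waCnt p (Function.update H k (t * H k)) (t * δ)).card := by
  classical
  have hH' : ∀ k', 0 ≤ Function.update H k (t * H k) k' := by
    intro k'
    by_cases hk : k' = k
    · subst hk; simp; have := hH k'; positivity
    · simp [hk, (hH k').le]
  have := waFiber k (0 : Fin n → ℤ) (waCnt p H δ) (waCnt p (Function.update H k (t * H k)) (t * δ))
    (fun _ => 1) ((3/t)^n) (by positivity) (by
    intro h0 hh0 U V hU hV
    rw [mem_waCnt (fun k => (hH k).le)] at hh0
    have := wa_shrink (fun j a => waM (pderiv j p)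
      (Function.update (fun k' i => (h0 k' i : ℝ)) k (Pi.single a 1)))
      (fun i j => waM_symm _ _ _ _ _) (H k) δ t (hH k) hδ hHδ ht ht1 U V ?_ ?_
    · simpa using this
    · intro u hu
      rw [hU, mem_waCnt (fun k => (hH k).le)] at hu
      refine ⟨fun i => ?_, fun j => ?_⟩
      · have := hu.1 k i
        simpa using this
      · have := hu.2 j
        rwa [wa_lin] at this
    · intro u h1 h2
      rw [hV, mem_waCnt hH']
      refine ⟨fun k' i => ?_, fun j => ?_⟩
      · by_cases hk : k' = k
        · subst hk; simpa using h1 i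
        · simpa [hk] using hh0.1 k' i
      · rw [wa_lin]; exact h2 j)
  simpa using this

lemma waCnt_iter {n r : ℕ} (p : MvPolynomial (Fin n) ℝ) (H δ t : ℝ)
    (hH : 0 < H) (hδ : 0 < δ) (hHδ : 2 * n * H * δ < 1)
    (ht : 0 < t) (ht1 : t ≤ 1) (m : ℕ) (hm : m ≤ r) :
    ((waCnt p (fun _ : Fin r => H) δ).card : ℝ) ≤ ((3 / t)^n)^m *
      (waCnt p (fun k : Fin r => if (k:ℕ) < m then t * H else H) (t^m * δ)).card := by
  induction m with
  | zero => simp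
  | succ m ih =>
    have hH2 : ∀ k : Fin r, 0 < if (k:ℕ) < m then t * H else H := by
      intro k; split_ifs <;> positivity
    have h1 := waCnt_step p (fun k : Fin r => if (k:ℕ) < m then t * H else H) (t^m * δ) t hH2
      (by positivity) ⟨m, hm⟩ (by
        simp only [lt_irrefl, if_false]
        have : t^m * δ ≤ δ := by
          have := pow_le_one₀ (n := m) ht.le ht1
          nlinarith
        calc 2 * n * H * (t^m * δ) ≤ 2 * n * H * δ := by gcongr
          _ < 1 := hHδ) ht ht1
    refine (ih (by omega)).trans ?_
    rw [pow_succ ((3/t)^n), mul_assoc]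
    apply mul_le_mul_of_nonneg_left _ (by positivity)
    refine h1.trans (le_of_eq ?_)
    have e1 : (Function.update (fun k : Fin r => if (k:ℕ) < m then t * H else H) ⟨m, hm⟩
        (t * if ((⟨m, hm⟩ : Fin r):ℕ) < m then t * H else H)) =
        (fun k : Fin r => if (k:ℕ) < m + 1 then t * H else H) := by
      ext k
      by_cases hk : k = ⟨m, hm⟩
      · subst hk; simp
      · have : (k:ℕ) ≠ m := fun h => hk (Fin.ext h)
        rw [Function.update_of_ne hk]
        have : (k:ℕ) < m ↔ (k:ℕ) < m + 1 := by omega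
        simp only [this]
    rw [e1, show t * (t^m * δ) = t^(m+1) * δ by ring]

lemma waCnt_shrink {n r : ℕ} (p : MvPolynomial (Fin n) ℝ) (H δ t : ℝ)
    (hH : 0 < H) (hδ : 0 < δ) (hHδ : 2 * n * H * δ < 1)
    (ht : 0 < t) (ht1 : t ≤ 1) :
    ((waCnt p (fun _ : Fin r => H) δ).card : ℝ) ≤ ((3 / t)^n)^r *
      (waCnt p (fun _ : Fin r => t * H) (t^r * δ)).card := by
  have := waCnt_iter (r := r) p H δ t hH hδ hHδ ht ht1 r le_rfl
  simpa using this

lemma wa_weyl_main {n r : ℕ} (hr : 0 < r) (p : MvPolynomial (Fin n) ℝ) (hp : waDegLt (r+2) p) (M Q : ℕ)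
    (hQ : M + 1 ≤ Q) (lo hi : Fin n → ℤ) (hM : ∀ j, hi j - lo j ≤ M) :
    ‖∑ x ∈ Finset.Icc lo hi, eC (eval (fun i => (x i : ℝ)) p)‖ ^ (2^r) ≤
      ((2*(M:ℝ)+1)^n)^(2^r - r - 1) * ((4 * Q * (1 + Real.log Q))^n *
        (waCnt p (fun _ : Fin r => 2 * (M:ℝ)) (1 / Q)).card) := by
  classical
  have hQ0 : 0 < Q := by omega
  have h1 := waWeyl M r (fun x => eval (fun i => (x i : ℝ)) p) lo hi hM
    (fun h => ∏ j, waW Q (waCell Q (waM (pderiv j p) (fun k i => (h k i : ℝ))))) (by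
      intro h lo' hi' hM'
      obtain ⟨c, hc⟩ := waIter_eq r p hp h
      simp only [hc]
      exact wa_linear_sum c _ lo' hi' M Q hM' hQ)
  refine h1.trans ?_
  apply mul_le_mul_of_nonneg_left _ (by positivity)
  have hS0 : 0 ≤ ∑ r ∈ Finset.range Q, waW Q r :=
    Finset.sum_nonneg (fun r hr => waW_nonneg (Finset.mem_range.mp hr))
  have h2 := waFiber (⟨0, hr⟩ : Fin r) (0 : Fin n → ℤ) (Fintype.piFinset (fun _ : Fin r => waBox n M))
    (waCnt p (fun _ : Fin r => 2 * (M:ℝ)) (1 / Q))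
    (fun h => ∏ j, waW Q (waCell Q (waM (pderiv j p) (fun k i => (h k i : ℝ)))))
    ((∑ r ∈ Finset.range Q, waW Q r)^n) (by positivity) (by
    intro h0 hh0 U V hU hV
    rw [Fintype.mem_piFinset] at hh0
    have hUe : U = waBox n M := by
      ext u
      rw [hU, Fintype.mem_piFinset]
      constructor
      · intro h; simpa using h ⟨0, hr⟩
      · intro h k
        by_cases hk : k = ⟨0, hr⟩
        · subst hk; simpa using h
        · simpa [hk] using hh0 k
    rw [hUe]
    simp only [wa_lin]
    apply wa_cells _ M Q hQ0 V
    intro u h1 h2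
    rw [hV, mem_waCnt (fun _ => by positivity)]
    refine ⟨fun k i => ?_, fun j => ?_⟩
    · by_cases hk : k = ⟨0, hr⟩
      · subst hk; simpa using h1 i
      · rw [Function.update_of_ne hk]
        have := (mem_waBox.mp (hh0 k)) i
        have h3 : |(h0 k i : ℝ)| ≤ M := by exact_mod_cast this
        have : (0:ℝ) ≤ M := by positivity
        linarith
    · rw [wa_lin]; exact h2 j)
  refine h2.trans ?_
  gcongr
  exact waW_sum Q

lemma wa_cut {K : Type*} [Field K] [Infinite K] {n : ℕ} (D : ℕ) :
    ∀ (I : Ideal (MvPolynomial (Fin n) K))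
    (_ : ∀ x : Fin n → K, (∀ g ∈ I, eval x g = 0) → ∀ t : K, ∀ g ∈ I, eval (t • x) g = 0)
    (_ : ringKrullDim (MvPolynomial (Fin n) K ⧸ I) ≤ ((D : ℕ∞) : WithBot ℕ∞)),
    ∃ ℓ : Fin D → Fin n → K, ∀ x : Fin n → K, (∀ g ∈ I, eval x g = 0) →
      (∀ k, ∑ i, ℓ k i * x i = 0) → x = 0 := by
  classical
  induction D with
  | zero =>
    intro I hcone hdim
    refine ⟨fun k => k.elim0, fun x hx _ => ?_⟩
    by_contra hx0
    obtain ⟨i, hi⟩ := Function.ne_iff.mp hx0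
    rw [ringKrullDim_quotient] at hdim
    let φ : MvPolynomial (Fin n) K →ₐ[K] Polynomial K :=
      aeval (fun i => Polynomial.C (x i) * Polynomial.X)
    have hφ : ∀ (t : K) g, Polynomial.eval t (φ g) = eval (t • x) g := by
      intro t g
      induction g using MvPolynomial.induction_on with
      | C a => simp [φ]
      | add p q hp hq => simp only [map_add, Polynomial.eval_add, hp, hq]
      | mul_X p j hp =>
        rw [map_mul, map_mul, Polynomial.eval_mul, hp]
        simp only [φ, aeval_X, eval_X, Polynomial.eval_mul, Polynomial.eval_C, Polynomial.eval_X,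
          Pi.smul_apply, smul_eq_mul]
        rw [mul_comm t]
    let p : PrimeSpectrum (MvPolynomial (Fin n) K) := ⟨RingHom.ker φ.toRingHom, RingHom.ker_isPrime _⟩
    let q : PrimeSpectrum (MvPolynomial (Fin n) K) := ⟨RingHom.ker (eval (0 : Fin n → K)), RingHom.ker_isPrime _⟩
    have hpq : p < q := by
      rw [← PrimeSpectrum.asIdeal_lt_asIdeal, lt_iff_le_not_ge]
      constructor
      · intro g hg
        have hg' : φ g = 0 := hg
        have := hφ 0 g
        rw [hg'] at this
        simp only [Polynomial.eval_zero, zero_smul] at this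
        exact this.symm
      · intro hle
        have h1 : (X i : MvPolynomial (Fin n) K) ∈ q.asIdeal := by
          change eval 0 (X i) = 0
          simp
        have h2 : φ (X i) = 0 := hle h1
        simp [φ] at h2
        exact hi h2
    have hpI : p ∈ PrimeSpectrum.zeroLocus (I : Set (MvPolynomial (Fin n) K)) := by
      rw [PrimeSpectrum.mem_zeroLocus]
      intro g hg
      change φ g = 0
      apply Polynomial.funext
      intro t
      rw [hφ, Polynomial.eval_zero]
      exact hcone x hx t g hg
    have hqI : q ∈ PrimeSpectrum.zeroLocus (I : Set (MvPolynomial (Fin n) K)) := by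
      rw [PrimeSpectrum.mem_zeroLocus] at hpI ⊢
      exact hpI.trans hpq.le
    have hs : (⟨p, hpI⟩ : PrimeSpectrum.zeroLocus (I : Set (MvPolynomial (Fin n) K))) < ⟨q, hqI⟩ := hpq
    have h1 := Order.krullDim_pos_iff.mpr ⟨_, _, hs⟩
    have h2 := h1.trans_le hdim
    simp at h2
  | succ D ih =>
    intro I hcone hdim
    let lin : (Fin n → K) →ₗ[K] MvPolynomial (Fin n) K :=
      ∑ i, (LinearMap.proj i).smulRight (X i)
    have hlin : ∀ ℓ, lin ℓ = ∑ i, ℓ i • X i := by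
      intro ℓ; simp [lin]
    let m : Ideal (MvPolynomial (Fin n) K) := RingHom.ker (eval (0 : Fin n → K))
    have hmmax : m.IsMaximal := RingHom.ker_isMaximal_of_surjective _ (fun a => ⟨C a, by simp⟩)
    let MP := (Ideal.finite_minimalPrimes_of_isNoetherianRing (MvPolynomial (Fin n) K) I).toFinset.filter (fun P => P ≠ m)
    let S : Finset (Subspace K (Fin n → K)) := MP.image (fun P => (P.restrictScalars K).comap lin)
    have hS : ⊤ ∉ S := by
      intro htop
      obtain ⟨P, hP, hPe⟩ := Finset.mem_image.mp htop
      simp only [MP, Finset.mem_filter, Set.Finite.mem_toFinset] at hP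
      apply hP.2
      have hPprime : P.IsPrime := hP.1.1.1
      have hX : ∀ i, (X i : MvPolynomial (Fin n) K) ∈ P := by
        intro i
        have : (Pi.single i 1 : Fin n → K) ∈ (P.restrictScalars K).comap lin := by rw [hPe]; trivial
        have h2 : lin (Pi.single i 1) ∈ P := this
        rw [hlin, Finset.sum_eq_single i] at h2
        · simpa using h2
        · intro j _ hj; simp [hj]
        · simp
      have hle : m ≤ P := by
        intro g hg
        have hg0 : eval (0 : Fin n → K) g = 0 := hg
        have key : ∀ g : MvPolynomial (Fin n) K, g - C (eval 0 g) ∈ P := by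
          intro g
          induction g using MvPolynomial.induction_on with
          | C a => simp
          | add p q hp hq =>
            have := P.add_mem hp hq
            convert this using 1
            simp; ring
          | mul_X p i hp =>
            simp only [map_mul, eval_X, Pi.zero_apply, mul_zero, map_zero, sub_zero]
            exact P.mul_mem_left _ (hX i)
        have := key g
        rwa [hg0, map_zero, sub_zero] at this
      exact (hmmax.eq_of_le hPprime.ne_top hle).symm
    have hne := Subspace.biUnion_ne_univ_of_top_notMem hS
    obtain ⟨ℓ, hℓ⟩ := (Set.ne_univ_iff_exists_notMem _).mp hne
    have hℓ' : ∀ P ∈ I.minimalPrimes, P ≠ m → lin ℓ ∉ P := by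
      intro P hP hPm hmem
      apply hℓ
      simp only [Set.mem_iUnion]
      refine ⟨(P.restrictScalars K).comap lin, Finset.mem_image_of_mem _ ?_, hmem⟩
      simp only [MP, Finset.mem_filter, Set.Finite.mem_toFinset]
      exact ⟨hP, hPm⟩
    let J := I ⊔ Ideal.span {lin ℓ}
    have hIJ : I ≤ J := le_sup_left
    have hlJ : lin ℓ ∈ J := (le_sup_right : _ ≤ J) (Ideal.mem_span_singleton_self _)
    have heval : ∀ x, eval x (lin ℓ) = ∑ i, ℓ i * x i := by
      intro x; rw [hlin]; simp [smul_eval]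
    have hJzero : ∀ x, (∀ g ∈ J, eval x g = 0) ↔ (∀ g ∈ I, eval x g = 0) ∧ ∑ i, ℓ i * x i = 0 := by
      intro x
      constructor
      · intro h
        exact ⟨fun g hg => h g (hIJ hg), by rw [← heval]; exact h _ hlJ⟩
      · rintro ⟨h1, h2⟩
        have : J ≤ RingHom.ker (eval x) := by
          apply sup_le
          · exact fun g hg => h1 g hg
          · rw [Ideal.span_singleton_le_iff_mem]
            change eval x (lin ℓ) = 0
            rw [heval, h2]
        exact fun g hg => this hg
    have hdimJ : ringKrullDim (MvPolynomial (Fin n) K ⧸ J) ≤ ((D : ℕ∞) : WithBot ℕ∞) := by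
      rw [ringKrullDim_quotient] at hdim ⊢
      apply iSup_le
      intro s
      have hIJz : ∀ z : PrimeSpectrum.zeroLocus (J : Set (MvPolynomial (Fin n) K)),
          (z : PrimeSpectrum _) ∈ PrimeSpectrum.zeroLocus (I : Set (MvPolynomial (Fin n) K)) := by
        intro z
        have := z.2
        rw [PrimeSpectrum.mem_zeroLocus] at this ⊢
        exact fun g hg => this (hIJ hg)
      let inc : PrimeSpectrum.zeroLocus (J : Set (MvPolynomial (Fin n) K)) →
          PrimeSpectrum.zeroLocus (I : Set (MvPolynomial (Fin n) K)) := fun z => ⟨z, hIJz z⟩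
      have hinc : StrictMono inc := fun a b hab => hab
      have hh := s.head.1.isPrime
      have hIh : I ≤ s.head.1.asIdeal := hIJz s.head
      obtain ⟨P, hP, hPle⟩ := Ideal.exists_minimalPrimes_le hIh
      by_cases hPm : P = m
      · -- head is maximal
        have hlen : s.length = 0 := by
          by_contra hlen
          have h1 : s.head < s.last := by
            apply s.strictMono
            rw [Fin.lt_def]
            simp only [Fin.val_zero, Fin.val_last]
            omega
          have h2 : s.head.1.asIdeal = m := by
            rw [hPm] at hPle
            exact (hmmax.eq_of_le hh.ne_top hPle).symm
          have h3 : s.head.1.asIdeal < s.last.1.asIdeal := h1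
          rw [h2] at h3
          exact s.last.1.isPrime.ne_top (hmmax.1.2 _ h3)
        rw [hlen]
        simp
      · have hlP := hℓ' P hP hPm
        have hPprime : P.IsPrime := hP.1.1
        let p0 : PrimeSpectrum.zeroLocus (I : Set (MvPolynomial (Fin n) K)) :=
          ⟨⟨P, hPprime⟩, by rw [PrimeSpectrum.mem_zeroLocus]; exact hP.1.2⟩
        have hlt : p0 < inc s.head := by
          change P < s.head.1.asIdeal
          refine lt_of_le_of_ne hPle ?_
          intro he
          apply hlP
          rw [he]
          exact s.head.2 hlJ
        let s2 : LTSeries (PrimeSpectrum.zeroLocus (I : Set (MvPolynomial (Fin n) K))) :=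
          (s.map inc hinc).cons p0 (by simpa using hlt)
        have := (Order.LTSeries.length_le_krullDim s2).trans hdim
        have h2 : s2.length = s.length + 1 := by simp [s2, LTSeries.map]
        rw [h2] at this
        have h3 : s.length + 1 ≤ D + 1 := by exact_mod_cast this
        have h4 : s.length ≤ D := by omega
        exact_mod_cast h4
    obtain ⟨ℓs, hℓs⟩ := ih J (by
      intro x hx t
      rw [hJzero] at hx ⊢
      refine ⟨hcone x hx.1 t, ?_⟩
      have := hx.2
      simp only [Pi.smul_apply, smul_eq_mul]
      rw [show ∑ i, ℓ i * (t * x i) = t * ∑ i, ℓ i * x i by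
        rw [Finset.mul_sum]; apply Finset.sum_congr rfl; intros; ring, this, mul_zero]) hdimJ
    refine ⟨Fin.cons ℓ ℓs, fun x hx hk => hℓs x ?_ ?_⟩
    · rw [hJzero]
      exact ⟨hx, by simpa using hk 0⟩
    · intro k
      simpa using hk k.succ

section waNull
variable {σ ι : Type} [Fintype σ] [Fintype ι] {K : Type*} [Field K]

def waGood (s : ℕ) (F : ι → MvPolynomial σ K) : Prop :=
  ∀ μ : σ →₀ ℕ, μ.degree = s → monomial μ (1:K) ∈ Ideal.span (Set.range F)

lemma wa_exists_le (μ : σ →₀ ℕ) (s : ℕ) (h : s ≤ μ.degree) : ∃ ν : σ →₀ ℕ, ν ≤ μ ∧ ν.degree = s := by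
  induction s with
  | zero => exact ⟨0, bot_le, by simp⟩
  | succ s ih =>
    obtain ⟨ν, h1, h2⟩ := ih (by omega)
    have hne : μ - ν ≠ 0 := by
      intro h0
      have : μ = ν := by
        rw [← tsub_add_cancel_of_le h1, h0, zero_add]
      subst this; omega
    obtain ⟨i, hi⟩ := Finsupp.ne_iff.mp hne
    refine ⟨ν + Finsupp.single i 1, ?_, by simp [h2]⟩
    intro j
    have hj := h1 j
    by_cases hij : i = j
    · subst hij
      simp at hi ⊢
      omega
    · simp [hij, hj]

lemma waGood.mono {s t : ℕ} (hst : s ≤ t) {F : ι → MvPolynomial σ K} (h : waGood s F) : waGood t F := by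
  intro μ hμ
  obtain ⟨ν, h1, h2⟩ := wa_exists_le μ s (by omega)
  have : monomial μ (1:K) = monomial (μ - ν) 1 * monomial ν 1 := by
    rw [monomial_mul, tsub_add_cancel_of_le h1, one_mul]
  rw [this]
  exact Ideal.mul_mem_left _ _ (h ν h2)

lemma wa_null_point [IsAlgClosed K] (F : ι → MvPolynomial σ K)
    (hF : ∀ x : σ → K, (∀ p, eval x (F p) = 0) → x = 0) : ∃ s, waGood s F := by
  have h1 : idealOfVars σ K ≤ (Ideal.span (Set.range F)).radical := by
    rw [← vanishingIdeal_zeroLocus_eq_radical (K := K)]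
    unfold idealOfVars
    rw [Ideal.span_le]
    rintro _ ⟨i, rfl⟩
    change X i ∈ vanishingIdeal K _
    rw [mem_vanishingIdeal_iff]
    intro x hx
    have : x = 0 := by
      apply hF
      intro p
      have := hx (F p) (Ideal.subset_span ⟨p, rfl⟩)
      simpa [aeval_eq_eval] using this
    simp [this]
  obtain ⟨s, hs⟩ := Ideal.exists_pow_le_of_le_radical_of_fg h1 (idealOfVars_fg σ K)
  refine ⟨s, fun μ hμ => hs ?_⟩
  rw [monomial_mem_pow_idealOfVars_iff _ _ one_ne_zero]
  exact hμ.ge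

lemma wa_hc_mul (a F : MvPolynomial σ K) (e s : ℕ) (hF : F.IsHomogeneous e) :
    homogeneousComponent s (a * F) = (if e ≤ s then homogeneousComponent (s - e) a else 0) * F := by
  conv_lhs => rw [← sum_homogeneousComponent a, Finset.sum_mul, map_sum]
  have h1 : ∀ k ∈ Finset.range (a.totalDegree + 1), homogeneousComponent s (homogeneousComponent k a * F) =
      if k + e = s then homogeneousComponent k a * F else 0 := by
    intro k _
    have := homogeneousComponent_of_mem (m := s) (n := k + e) (p := homogeneousComponent k a * F)
      (((homogeneousComponent_isHomogeneous k a).mul hF))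
    rw [this]
    simp only [eq_comm]
  rw [Finset.sum_congr rfl h1]
  split_ifs with he
  · rw [Finset.sum_eq_single (s - e)]
    · rw [if_pos (by omega)]
    · intro k _ hk
      rw [if_neg (by omega)]
    · intro hk
      rw [if_pos (by omega), homogeneousComponent_eq_zero, zero_mul]
      simp at hk; omega
  · rw [zero_mul]
    apply Finset.sum_eq_zero
    intro k _
    rw [if_neg (by omega)]

lemma wa_hom_rep (e : ι → ℕ) (F : ι → MvPolynomial σ K) (hF : ∀ p, (F p).IsHomogeneous (e p)) (s : ℕ)
    (g : MvPolynomial σ K) (hg : g.IsHomogeneous s) (hmem : g ∈ Ideal.span (Set.range F)) :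
    ∃ h : ι → MvPolynomial σ K, g = ∑ p, h p * F p ∧ (∀ p, (h p * F p).IsHomogeneous s) ∧
      ∀ p, e p ≤ s ∧ (h p).IsHomogeneous (s - e p) ∨ h p = 0 := by
  rw [Ideal.mem_span_range_iff_exists_fun] at hmem
  obtain ⟨a, ha⟩ := hmem
  refine ⟨fun p => if e p ≤ s then homogeneousComponent (s - e p) (a p) else 0, ?_, ?_, ?_⟩
  · simp_rw [← wa_hc_mul (a _) (F _) (e _) s (hF _)]
    rw [← map_sum, ha, homogeneousComponent_eq_self hg]
  · intro p
    rw [← wa_hc_mul (a _) (F _) (e _) s (hF _)]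
    exact homogeneousComponent_isHomogeneous _ _
  · intro p
    by_cases h : e p ≤ s
    · left
      simp only [h, if_true, true_and]
      exact homogeneousComponent_isHomogeneous _ _
    · right
      simp [h]

open Classical in
def waMons (σ : Type) [Fintype σ] (k : ℕ) : Finset (σ →₀ ℕ) := Finset.finsuppAntidiag Finset.univ k

lemma mem_waMons {k : ℕ} {m : σ →₀ ℕ} : m ∈ waMons σ k ↔ m.degree = k := by
  classical
  unfold waMons
  rw [Finset.mem_finsuppAntidiag]
  simp [Finsupp.degree_eq_sum]

lemma wa_hom_sum {A : Type*} [CommRing A] {k : ℕ} {g : MvPolynomial σ A} (hg : g.IsHomogeneous k) :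
    g = ∑ m : waMons σ k, monomial (m : σ →₀ ℕ) (coeff m g) := by
  rw [Finset.sum_coe_sort (waMons σ k) (fun m => monomial m (coeff m g))]
  conv_lhs => rw [g.as_sum]
  apply Finset.sum_subset
  · intro m hm
    rw [mem_waMons]
    rw [mem_support_iff] at hm
    by_contra h
    exact hm (hg.coeff_eq_zero h)
  · intro m _ hm
    rw [notMem_support_iff] at hm
    simp [hm]

/-- Coefficient family to forms. -/
def waForm {A : Type*} [CommRing A] (e : ι → ℕ) (c : (Σ p : ι, waMons σ (e p)) → A) (p : ι) :
    MvPolynomial σ A :=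
  ∑ m : waMons σ (e p), monomial (m : σ →₀ ℕ) (c ⟨p, m⟩)

lemma waForm_hom {A : Type*} [CommRing A] (e : ι → ℕ) (c : (Σ p : ι, waMons σ (e p)) → A) (p : ι) :
    (waForm e c p).IsHomogeneous (e p) := by
  unfold waForm
  apply IsHomogeneous.sum
  intro m _
  apply isHomogeneous_monomial
  exact mem_waMons.mp m.2

lemma wa_open (e : ι → ℕ) (c0 : (Σ p : ι, waMons σ (e p)) → K) (s : ℕ) (hs : waGood s (waForm e c0)) :
    ∃ D : MvPolynomial (Σ p : ι, waMons σ (e p)) K, eval c0 D ≠ 0 ∧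
      ∀ c, eval c D ≠ 0 → waGood s (waForm e c) := by
  classical
  have hrep : ∀ μ : waMons σ s, ∃ h : ι → MvPolynomial σ K,
      monomial (μ : σ →₀ ℕ) (1:K) = ∑ p, h p * waForm e c0 p ∧
      ∀ p, e p ≤ s ∧ (h p).IsHomogeneous (s - e p) ∨ h p = 0 := by
    intro μ
    obtain ⟨h, h1, _, h2⟩ := wa_hom_rep e (waForm e c0) (waForm_hom e c0) s (monomial (μ : σ →₀ ℕ) (1:K))
      (isHomogeneous_monomial _ (mem_waMons.mp μ.2)) (hs μ (mem_waMons.mp μ.2))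
    exact ⟨h, h1, h2⟩
  choose h hh1 hh2 using hrep
  let T := Σ p : ι, waMons σ (e p)
  let Gu : waMons σ s → MvPolynomial σ (MvPolynomial T K) := fun μ =>
    ∑ p, map C (h μ p) * waForm e (fun t => (X t : MvPolynomial T K)) p
  let Mu : Matrix (waMons σ s) (waMons σ s) (MvPolynomial T K) := fun μ ν => coeff (ν : σ →₀ ℕ) (Gu μ)
  let G : (T → K) → waMons σ s → MvPolynomial σ K := fun c μ => ∑ p, h μ p * waForm e c p
  have hG : ∀ c μ, map (eval c) (Gu μ) = G c μ := by
    intro c μ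
    simp only [Gu, G, map_sum, map_mul]
    apply Finset.sum_congr rfl
    intro p _
    congr 1
    · have : (eval c).comp (C : K →+* MvPolynomial T K) = RingHom.id K := by ext; simp
      rw [MvPolynomial.map_map, this, MvPolynomial.map_id]
    · unfold waForm
      simp [map_monomial]
  have hM : ∀ c, (eval c).mapMatrix Mu = fun μ ν : waMons σ s => coeff (ν : σ →₀ ℕ) (G c μ) := by
    intro c
    ext μ ν
    rw [RingHom.mapMatrix_apply, Matrix.map_apply, ← hG, coeff_map]
  have hGhom : ∀ c μ, (G c μ).IsHomogeneous s := by
    intro c μ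
    apply IsHomogeneous.sum
    intro p _
    rcases hh2 μ p with ⟨h1, h2⟩ | h1
    · have := h2.mul (waForm_hom e c p)
      rwa [Nat.sub_add_cancel h1] at this
    · rw [h1, zero_mul]; exact isHomogeneous_zero _ _ _
  refine ⟨Mu.det, ?_, ?_⟩
  · rw [RingHom.map_det, hM]
    have : (fun μ ν : waMons σ s => coeff (ν : σ →₀ ℕ) (G c0 μ)) = (1 : Matrix (waMons σ s) (waMons σ s) K) := by
      ext μ ν
      simp only [G]
      rw [← hh1, coeff_monomial, Matrix.one_apply]
      simp only [Subtype.ext_iff]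
    rw [this, Matrix.det_one]
    exact one_ne_zero
  · intro c hc μ hμ
    rw [RingHom.map_det, hM] at hc
    set A : Matrix (waMons σ s) (waMons σ s) K := fun μ ν => coeff (ν : σ →₀ ℕ) (G c μ) with hA
    have hinv : A⁻¹ * A = 1 := Matrix.nonsing_inv_mul A (Ne.isUnit hc)
    let κ : waMons σ s := ⟨μ, mem_waMons.mpr hμ⟩
    have e1 : monomial μ (1:K) = ∑ ν, C (A⁻¹ κ ν) * G c ν := by
      have : ∀ ν, C (A⁻¹ κ ν) * G c ν = ∑ τ : waMons σ s, monomial (τ : σ →₀ ℕ) (A⁻¹ κ ν * A ν τ) := by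
        intro ν
        conv_lhs => rw [wa_hom_sum (hGhom c ν)]
        rw [Finset.mul_sum]
        simp [C_mul_monomial, hA]
      rw [Finset.sum_congr rfl (fun ν _ => this ν), Finset.sum_comm]
      have h2 : ∀ τ : waMons σ s, ∑ ν, monomial (τ : σ →₀ ℕ) (A⁻¹ κ ν * A ν τ) =
          monomial (τ : σ →₀ ℕ) ((1 : Matrix (waMons σ s) (waMons σ s) K) κ τ) := by
        intro τ
        rw [← hinv, Matrix.mul_apply, ← map_sum]
      rw [Finset.sum_congr rfl (fun τ _ => h2 τ), Finset.sum_eq_single κ]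
      · simp [κ]
      · intro τ _ hτ
        rw [Matrix.one_apply_ne hτ.symm, map_zero]
      · simp
    rw [e1]
    apply Ideal.sum_mem
    intro ν _
    apply Ideal.mul_mem_left
    apply Ideal.sum_mem
    intro p _
    exact Ideal.mul_mem_left _ _ (Ideal.subset_span ⟨p, rfl⟩)

lemma wa_null_uniform (K : Type*) [Field K] [IsAlgClosed K] (e : ι → ℕ) : ∃ s : ℕ, ∀ F : ι → MvPolynomial σ K,
    (∀ p, (F p).IsHomogeneous (e p)) → (∀ x : σ → K, (∀ p, eval x (F p) = 0) → x = 0) → waGood s F := by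
  classical
  let T := Σ p : ι, waMons σ (e p)
  let U : Set (T → K) := {c | ∃ s, waGood s (waForm e c)}
  have hU : ∀ c : U, ∃ s, ∃ D : MvPolynomial T K, eval (c : T → K) D ≠ 0 ∧
      ∀ c', eval c' D ≠ 0 → waGood s (waForm e c') := by
    intro c
    obtain ⟨s, hs⟩ := c.2
    obtain ⟨D, h1, h2⟩ := wa_open e (c : T → K) s hs
    exact ⟨s, D, h1, h2⟩
  choose s D hD1 hD2 using hU
  have hfg : (Ideal.span (Set.range D)).FG := IsNoetherian.noetherian _
  obtain ⟨S, hS1, hS2⟩ := (Submodule.fg_span_iff_fg_span_finset_subset (Set.range D)).mp hfg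
  have hch : ∀ g : S, ∃ c : U, D c = g := fun g => hS1 g.2
  choose w hw using hch
  refine ⟨Finset.univ.sup (fun g : S => s (w g)), fun F hF hz => ?_⟩
  have hFc : F = waForm e (fun t : T => coeff (t.2 : σ →₀ ℕ) (F t.1)) := by
    ext1 p
    exact wa_hom_sum (hF p)
  obtain ⟨s0, hs0⟩ := wa_null_point F hz
  set c0 : T → K := fun t : T => coeff (t.2 : σ →₀ ℕ) (F t.1) with hc0
  have hcU : c0 ∈ U := ⟨s0, by rw [← hFc]; exact hs0⟩
  have h1 := hD1 ⟨c0, hcU⟩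
  by_contra hbad
  apply h1
  have hmem : D ⟨c0, hcU⟩ ∈ Submodule.span (MvPolynomial T K) (S : Set (MvPolynomial T K)) := by
    rw [← hS2]; exact Submodule.subset_span ⟨_, rfl⟩
  have hle : Submodule.span (MvPolynomial T K) (S : Set (MvPolynomial T K)) ≤ RingHom.ker (eval c0) := by
    apply Ideal.span_le.mpr
    intro g hg
    change eval c0 g = 0
    by_contra hne
    apply hbad
    rw [hFc]
    have h2 := hD2 (w ⟨g, hg⟩) c0 (by rw [hw]; exact hne)
    exact h2.mono (Finset.le_sup (f := fun g : S => s (w g)) (Finset.mem_univ _))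
  exact hle hmem

end waNull

section waCounting
variable {σ ι Λ : Type} [Fintype σ] [Fintype ι] [Fintype Λ] {K : Type*} [Field K]

/-- functions on `X` spanned by small monomials times bounded powers of linear forms -/
def waSpan (X : Finset (σ → ℤ)) (L : Λ → MvPolynomial σ K) (s k : ℕ) : Submodule K (X → K) :=
  Submodule.span K {f | ∃ (m : σ → ℕ) (β : Λ → ℕ), (∀ i, m i < s) ∧ ∑ l, β l ≤ k ∧
    f = fun x => (∏ i, ((x.1 i : ℤ) : K) ^ m i) * ∏ l, (eval (fun i => ((x.1 i : ℤ) : K)) (L l)) ^ β l}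

lemma waSpan_mono (X : Finset (σ → ℤ)) (L : Λ → MvPolynomial σ K) (s : ℕ) {k l : ℕ} (hkl : k ≤ l) :
    waSpan X L s k ≤ waSpan X L s l := by
  apply Submodule.span_mono
  rintro f ⟨m, β, h1, h2, h3⟩
  exact ⟨m, β, h1, h2.trans hkl, h3⟩

lemma waSpan_mul (X : Finset (σ → ℤ)) (L : Λ → MvPolynomial σ K) (s k : ℕ) (l : Λ) (f : X → K)
    (hf : f ∈ waSpan X L s k) :
    (fun x => f x * eval (fun i => ((x.1 i : ℤ) : K)) (L l)) ∈ waSpan X L s (k+1) := by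
  classical
  induction hf using Submodule.span_induction with
  | zero => simp only [Pi.zero_apply, zero_mul]; exact Submodule.zero_mem _
  | add f g _ _ hf hg =>
    have := Submodule.add_mem _ hf hg
    convert this using 1
    ext x; simp [add_mul]
  | smul c f _ hf =>
    have := Submodule.smul_mem _ c hf
    convert this using 1
    ext x; simp [mul_assoc]
  | mem f hf =>
    obtain ⟨m, β, h1, h2, rfl⟩ := hf
    apply Submodule.subset_span
    refine ⟨m, β + Pi.single l 1, h1, ?_, ?_⟩
    · simp only [Pi.add_apply, Finset.sum_add_distrib]
      simp; omega
    · ext x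
      simp only [Pi.add_apply, pow_add, Finset.prod_mul_distrib]
      rw [mul_assoc]
      congr 2
      rw [Finset.prod_eq_single l]
      · simp
      · intro b _ hb; simp [hb]
      · simp

lemma waSpan_poly (X : Finset (σ → ℤ)) (e : ι → ℕ) (F : ι → MvPolynomial σ K) (hF : ∀ p, (F p).IsHomogeneous (e p))
    (L : Λ → MvPolynomial σ K) (hL : ∀ l, (L l).IsHomogeneous 1) (s : ℕ)
    (hgood : waGood s (Sum.elim F L))
    (hX : ∀ x ∈ X, ∀ p, eval (fun i => ((x i : ℤ) : K)) (F p) = 0) (k : ℕ) :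
    ∀ g : MvPolynomial σ K, g.totalDegree ≤ k →
      (fun x : X => eval (fun i => ((x.1 i : ℤ) : K)) g) ∈ waSpan X L s k := by
  classical
  induction k using Nat.strong_induction_on with
  | _ k ih =>
  have hmono : ∀ μ : σ →₀ ℕ, μ.degree ≤ k →
      (fun x : X => eval (fun i => ((x.1 i : ℤ) : K)) (monomial μ (1:K))) ∈ waSpan X L s k := by
    intro μ hμ
    by_cases hs : μ.degree < s
    · apply Submodule.subset_span
      refine ⟨μ, 0, ?_, by simp, ?_⟩
      · intro i
        exact (Finsupp.le_degree i μ).trans_lt hs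
      · ext x
        simp [eval_monomial, Finsupp.prod_fintype]
    · push Not at hs
      obtain ⟨ν, h1, h2⟩ := wa_exists_le μ s hs
      obtain ⟨h, hh1, _, hh2⟩ := wa_hom_rep (Sum.elim e (fun _ : Λ => 1)) (Sum.elim F L)
        (by rintro (p | l); exacts [hF p, hL l]) s (monomial ν 1) (isHomogeneous_monomial _ h2) (hgood ν h2)
      have hdeg : (μ - ν).degree + s = μ.degree := by
        rw [← h2, ← map_add, tsub_add_cancel_of_le h1]
      have e1 : (fun x : X => eval (fun i => ((x.1 i : ℤ) : K)) (monomial μ (1:K))) =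
          ∑ l : Λ, fun x : X => eval (fun i => ((x.1 i : ℤ) : K)) (monomial (μ - ν) 1 * h (Sum.inr l)) *
            eval (fun i => ((x.1 i : ℤ) : K)) (L l) := by
        ext x
        have : monomial μ (1:K) = monomial (μ - ν) 1 * monomial ν 1 := by
          rw [monomial_mul, tsub_add_cancel_of_le h1, one_mul]
        rw [this, hh1, map_mul, map_sum, Fintype.sum_sum_type]
        rw [Finset.sum_eq_zero (s := (Finset.univ : Finset ι)) (by
          intro p _
          rw [map_mul, Sum.elim_inl, hX x.1 x.2 p, mul_zero]), zero_add, Finset.mul_sum, Finset.sum_apply]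
        apply Finset.sum_congr rfl
        intro l _
        rw [map_mul, map_mul, Sum.elim_inr]; ring
      rw [e1]
      apply Submodule.sum_mem
      intro l _
      rcases hh2 (Sum.inr l) with ⟨a1, a2⟩ | a1
      · simp only [Sum.elim_inr] at a1 a2
        have hk : 0 < k := by omega
        obtain ⟨k', rfl⟩ : ∃ k', k = k' + 1 := ⟨k - 1, by omega⟩
        apply waSpan_mul
        apply ih k' (by omega)
        refine (totalDegree_mul _ _).trans ?_
        have b1 : (monomial (μ - ν) (1:K)).totalDegree ≤ (μ - ν).degree := by
          refine (totalDegree_monomial_le (μ - ν) (1:K)).trans (le_of_eq ?_)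
          rw [Finsupp.degree_eq_sum, Finsupp.sum_fintype _ _ (by simp)]
          rfl
        have b2 := a2.totalDegree_le
        omega
      · rw [a1]
        simp only [mul_zero, map_zero, zero_mul]
        exact Submodule.zero_mem _
  intro g hg
  have e1 : (fun x : X => eval (fun i => ((x.1 i : ℤ) : K)) g) = ∑ μ ∈ g.support, coeff μ g •
      (fun x : X => eval (fun i => ((x.1 i : ℤ) : K)) (monomial μ (1:K))) := by
    ext x
    conv_lhs => rw [g.as_sum, map_sum]
    rw [Finset.sum_apply]
    apply Finset.sum_congr rfl
    intro μ _
    simp [eval_monomial]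
  rw [e1]
  apply Submodule.sum_mem
  intro μ hμ
  apply Submodule.smul_mem
  apply hmono
  have := le_totalDegree hμ
  rw [Finsupp.sum_fintype _ _ (by simp)] at this
  rw [Finsupp.degree_eq_sum]
  omega

lemma wa_count [CharZero K] (X : Finset (σ → ℤ)) (e : ι → ℕ) (F : ι → MvPolynomial σ K)
    (hF : ∀ p, (F p).IsHomogeneous (e p))
    (L : Λ → MvPolynomial σ K) (hL : ∀ l, (L l).IsHomogeneous 1) (s : ℕ)
    (hgood : waGood s (Sum.elim F L))
    (hX : ∀ x ∈ X, ∀ p, eval (fun i => ((x i : ℤ) : K)) (F p) = 0) (B : ℕ)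
    (hB : ∀ x ∈ X, ∀ i, |x i| ≤ B) :
    X.card ≤ s ^ Fintype.card σ * (Fintype.card σ * (2 * B) + 1) ^ Fintype.card Λ := by
  classical
  set A := Fintype.card σ * (2 * B) with hA
  have htop : waSpan X L s A = ⊤ := by
    rw [eq_top_iff]
    intro f _
    have e1 : f = ∑ x0 : X, f x0 • (Pi.single x0 1 : X → K) := by
      ext x
      simp [Finset.sum_apply, Pi.single_apply]
    rw [e1]
    apply Submodule.sum_mem
    intro x0 _
    apply Submodule.smul_mem
    let g : MvPolynomial σ K := ∏ i, ∏ v ∈ (Finset.Icc (-(B:ℤ)) B).erase (x0.1 i), (MvPolynomial.X i - C (v : K))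
    have hg : g.totalDegree ≤ A := by
      refine (totalDegree_finset_prod _ _).trans ?_
      rw [hA, ← smul_eq_mul]
      unfold Fintype.card
      apply Finset.sum_le_card_nsmul
      intro i _
      refine (totalDegree_finset_prod _ _).trans ?_
      have : ∀ v ∈ (Finset.Icc (-(B:ℤ)) B).erase (x0.1 i), (MvPolynomial.X i - C (v : K)).totalDegree ≤ 1 := by
        intro v _
        refine (totalDegree_sub _ _).trans ?_
        exact max_le (by rw [totalDegree_X]) (by rw [totalDegree_C]; omega)
      refine (Finset.sum_le_card_nsmul _ _ _ this).trans ?_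
      rw [Finset.card_erase_of_mem]
      · simp; omega
      · rw [Finset.mem_Icc, ← abs_le]; exact hB x0.1 x0.2 i
    have hgm := waSpan_poly X e F hF L hL s hgood hX A g hg
    have hgx : ∀ x : X, eval (fun i => ((x.1 i : ℤ) : K)) g =
        ∏ i, ∏ v ∈ (Finset.Icc (-(B:ℤ)) B).erase (x0.1 i), (((x.1 i : ℤ) : K) - (v : K)) := by
      intro x
      simp only [g, map_prod, map_sub, eval_X, eval_C]
    have hne : eval (fun i => ((x0.1 i : ℤ) : K)) g ≠ 0 := by
      rw [hgx, Finset.prod_ne_zero_iff]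
      intro i _
      rw [Finset.prod_ne_zero_iff]
      intro v hv
      rw [sub_ne_zero]
      intro h
      rw [Int.cast_inj] at h
      exact Finset.ne_of_mem_erase hv h.symm
    have e2 : (Pi.single x0 1 : X → K) = (eval (fun i => ((x0.1 i : ℤ) : K)) g)⁻¹ •
        (fun x : X => eval (fun i => ((x.1 i : ℤ) : K)) g) := by
      ext x
      by_cases hx : x = x0
      · subst hx
        simp [hne]
      · simp only [Pi.single_apply, hx, if_false, Pi.smul_apply, smul_eq_mul]
        have : ∃ i, x.1 i ≠ x0.1 i := by
          by_contra hcon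
          push Not at hcon
          exact hx (Subtype.ext (funext hcon))
        obtain ⟨i, hi⟩ := this
        rw [hgx x, Finset.prod_eq_zero (Finset.mem_univ i), mul_zero]
        apply Finset.prod_eq_zero (i := x.1 i)
        · rw [Finset.mem_erase, Finset.mem_Icc, ← abs_le]
          exact ⟨hi, hB x.1 x.2 i⟩
        · simp
    rw [e2]
    exact Submodule.smul_mem _ _ hgm
  let gen : (σ → Fin s) × (Λ → Fin (A+1)) → (X → K) := fun mb x =>
    (∏ i, ((x.1 i : ℤ) : K) ^ (mb.1 i : ℕ)) *
      ∏ l, (eval (fun i => ((x.1 i : ℤ) : K)) (L l)) ^ (mb.2 l : ℕ)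
  have hle : waSpan X L s A ≤ Submodule.span K (Set.range gen) := by
    apply Submodule.span_mono
    rintro f ⟨m, β, h1, h2, rfl⟩
    refine ⟨(fun i => ⟨m i, h1 i⟩, fun l => ⟨β l, ?_⟩), rfl⟩
    have : β l ≤ ∑ l, β l := Finset.single_le_sum (fun _ _ => Nat.zero_le _) (Finset.mem_univ l)
    omega
  have hfin : Module.finrank K (Submodule.span K (Set.range gen)) ≤ Fintype.card ((σ → Fin s) × (Λ → Fin (A+1))) :=
    finrank_range_le_card gen
  rw [htop, top_le_iff] at hle
  rw [hle, finrank_top, Module.finrank_fintype_fun_eq_card, Fintype.card_coe] at hfin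
  simpa using hfin

end waCounting

section waApply
variable {n r : ℕ} {K : Type} [Field K]

/-- the multilinear form as a polynomial in blocks of variables -/
def waBlk (r : ℕ) (p : MvPolynomial (Fin n) K) : MvPolynomial (Fin r × Fin n) K :=
  waM (map C p) (fun (k : Fin r) i => X (k, i))

lemma waBlk_eval (p : MvPolynomial (Fin n) K) (y : Fin r × Fin n → K) :
    eval y (waBlk r p) = waM p (fun k i => y (k, i)) := by
  unfold waBlk
  rw [← waM_map, MvPolynomial.map_map]
  have : (eval y).comp (C : K →+* MvPolynomial (Fin r × Fin n) K) = RingHom.id K := by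
    ext a; simp
  rw [this, MvPolynomial.map_id]
  simp

lemma waBlk_hom (p : MvPolynomial (Fin n) K) : (waBlk r p).IsHomogeneous r := by
  unfold waBlk waM
  apply IsHomogeneous.sum
  intro i _
  have : waTr (map (C : K →+* MvPolynomial (Fin r × Fin n) K) p) i = C (waTr p i) := by
    unfold waTr
    rw [map_mul, coeff_map, map_natCast]
  rw [this]
  apply IsHomogeneous.C_mul
  have := IsHomogeneous.prod (Finset.univ : Finset (Fin r))
    (fun k => (X (k, i k) : MvPolynomial (Fin r × Fin n) K)) (fun _ => 1) (fun k _ => isHomogeneous_X _ _)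
  simpa using this

lemma wa_eval_smul {e : ℕ} (p : MvPolynomial (Fin n) K) (hp : p.IsHomogeneous e) (t : K) (x : Fin n → K) :
    eval (t • x) p = t ^ e * eval x p := by
  rw [eval_eq, eval_eq, Finset.mul_sum]
  apply Finset.sum_congr rfl
  intro m hm
  have h1 := hp (mem_support_iff.mp hm)
  have h2 : ∏ i ∈ m.support, (t • x) i ^ m i = t ^ e * ∏ i ∈ m.support, x i ^ m i := by
    simp only [Pi.smul_apply, smul_eq_mul, mul_pow, Finset.prod_mul_distrib]
    rw [Finset.prod_pow_eq_pow_sum]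
    congr 2
    rw [← h1, Finsupp.weight_apply, Finsupp.sum]
    simp
  rw [h2]; ring

lemma wa_diag_count [CharZero K] [IsAlgClosed K] (n r' D : ℕ) : ∃ s : ℕ, ∀ g : MvPolynomial (Fin n) K,
    g.IsHomogeneous (r'+2) →
    ringKrullDim (MvPolynomial (Fin n) K ⧸ Ideal.span (Set.range fun j : Fin n => pderiv j g)) ≤
      ((D : ℕ∞) : WithBot ℕ∞) →
    ∀ (X : Finset (Fin (r'+1) → Fin n → ℤ)) (B : ℕ), (∀ h ∈ X, ∀ k i, |h k i| ≤ B) →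
    (∀ h ∈ X, ∀ j, waM (pderiv j g) (fun k i => ((h k i : ℤ) : K)) = 0) →
    X.card ≤ s ^ ((r'+1)*n) * ((r'+1)*n*(2*B)+1)^(r'*n+D) := by
  classical
  obtain ⟨s, hs⟩ := wa_null_uniform (σ := Fin (r'+1) × Fin n)
    (ι := Fin n ⊕ ((Fin r' × Fin n) ⊕ Fin D)) K (Sum.elim (fun _ => r'+1) (fun _ => 1))
  refine ⟨s, fun g hg hdim X B hB h0 => ?_⟩
  have hpd : ∀ j, (pderiv j g).IsHomogeneous (r'+1) := fun j => hg.pderiv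
  have hinf : Infinite K := IsAlgClosed.instInfinite
  have hmem : ∀ x : Fin n → K, (∀ j, eval x (pderiv j g) = 0) →
      ∀ q ∈ Ideal.span (Set.range fun j : Fin n => pderiv j g), eval x q = 0 := by
    intro x hx q hq
    have : Ideal.span (Set.range fun j : Fin n => pderiv j g) ≤ RingHom.ker (eval x) := by
      rw [Ideal.span_le]
      rintro _ ⟨j, rfl⟩
      exact hx j
    exact this hq
  obtain ⟨ℓ, hℓ⟩ := wa_cut D (Ideal.span (Set.range fun j : Fin n => pderiv j g)) (by
    intro x hx t
    apply hmem
    intro j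
    rw [wa_eval_smul _ (hpd j), hx _ (Ideal.subset_span ⟨j, rfl⟩), mul_zero]) hdim
  let F : Fin n → MvPolynomial (Fin (r'+1) × Fin n) K := fun j => waBlk (r'+1) (pderiv j g)
  let L : (Fin r' × Fin n) ⊕ Fin D → MvPolynomial (Fin (r'+1) × Fin n) K :=
    Sum.elim (fun ki => MvPolynomial.X (ki.1.succ, ki.2) - MvPolynomial.X (0, ki.2))
      (fun k => ∑ i, C (ℓ k i) * MvPolynomial.X (0, i))
  have hF : ∀ j, (F j).IsHomogeneous (r'+1) := fun j => waBlk_hom _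
  have hL : ∀ l, (L l).IsHomogeneous 1 := by
    rintro (ki | k)
    · exact (isHomogeneous_X _ _).sub (isHomogeneous_X _ _)
    · exact IsHomogeneous.sum _ _ _ fun i _ => (isHomogeneous_X _ _).C_mul _
  have hgood : waGood s (Sum.elim F L) := by
    apply hs
    · rintro (j | l)
      · exact hF j
      · exact hL l
    · intro y hy
      have e0 : ∀ k i, y (k, i) = y (0, i) := by
        intro k i
        refine Fin.cases rfl (fun k => ?_) k
        have := hy (Sum.inr (Sum.inl (k, i)))
        simp only [Sum.elim_inr, Sum.elim_inl, L, map_sub, eval_X] at this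
        exact sub_eq_zero.mp this
      have e1 : (fun i => y (0, i)) = 0 := by
        apply hℓ
        · apply hmem
          intro j
          have := hy (Sum.inl j)
          simp only [Sum.elim_inl, F] at this
          rw [waBlk_eval] at this
          simp only [e0] at this
          rw [waM_diag _ (hpd j)] at this
          rcases mul_eq_zero.mp this with h | h
          · exact absurd h (Nat.cast_ne_zero.mpr (Nat.factorial_ne_zero _))
          · exact h
        · intro k
          have := hy (Sum.inr (Sum.inr k))
          simpa [L] using this
      ext ⟨k, i⟩
      rw [e0]
      exact congrFun e1 i
  let u : (Fin (r'+1) → Fin n → ℤ) ≃ (Fin (r'+1) × Fin n → ℤ) := (Equiv.curry _ _ _).symm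
  have hu : ∀ h k i, u h (k, i) = h k i := fun h k i => rfl
  have := wa_count (X.map u.toEmbedding) (fun _ => r'+1) F hF L hL s hgood (by
    intro x hx j
    rw [Finset.mem_map] at hx
    obtain ⟨h, hh, rfl⟩ := hx
    simp only [F]
    rw [waBlk_eval]
    exact h0 h hh j) B (by
    rintro x hx ⟨k, i⟩
    rw [Finset.mem_map] at hx
    obtain ⟨h, hh, rfl⟩ := hx
    exact hB h hh k i)
  simpa using this

end waApply

lemma wa_delta_le {n R : ℕ} (g : Fin R → MvPolynomial (Fin n) ℤ) (Δ : ℕ)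
    (h : ((Δ : ℕ∞) : WithBot ℕ∞) = birchDelta n R g) : Δ ≤ n := by
  have : birchDelta n R g ≤ ((n : ℕ∞) : WithBot ℕ∞) := by
    unfold birchDelta
    apply iSup₂_le
    intro b _
    unfold singDim
    refine (ringKrullDim_quotient_le _).trans ?_
    rw [MvPolynomial.ringKrullDim_of_isNoetherianRing]
    simp
  rw [← h] at this
  exact_mod_cast this

/-- the counting bound for a degenerate pencil member -/
lemma wa_final_count (n r' : ℕ) : ∃ s : ℕ, ∀ (R : ℕ) (g : Fin R → MvPolynomial (Fin n) ℤ),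
    (∀ i, (g i).IsHomogeneous (r'+2)) → ∀ Δ : ℕ, ((Δ : ℕ∞) : WithBot ℕ∞) = birchDelta n R g →
    ∀ b : Fin R → ℤ, b ≠ 0 →
    ∀ (X : Finset (Fin (r'+1) → Fin n → ℤ)) (B : ℕ), (∀ h ∈ X, ∀ k i, |h k i| ≤ B) →
    (∀ h ∈ X, ∀ j, ∑ i, b i * waM (pderiv j (g i)) h = 0) →
    X.card ≤ s ^ ((r'+1)*n) * ((r'+1)*n*(2*B)+1)^(r'*n+Δ) := by
  choose S hS using fun D => wa_diag_count (K := Qbar) n r' D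
  refine ⟨∑ D ∈ Finset.range (n+1), S D, fun R g hg Δ hΔ b hb X B hB h0 => ?_⟩
  have hΔn := wa_delta_le g Δ hΔ
  have hle : S Δ ≤ ∑ D ∈ Finset.range (n+1), S D :=
    Finset.single_le_sum (fun _ _ => Nat.zero_le _) (Finset.mem_range.mpr (by omega))
  refine (hS Δ (MvPolynomial.map (Int.castRingHom Qbar) (∑ i, b i • g i)) ?_ ?_ X B hB ?_).trans ?_
  · apply IsHomogeneous.map
    apply IsHomogeneous.sum
    intro i _
    rw [smul_eq_C_mul]
    exact (hg i).C_mul _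
  · rw [hΔ]
    exact le_iSup₂_of_le b hb le_rfl
  · intro h hh j
    have := waM_map (Int.castRingHom Qbar) (pderiv j (∑ i, b i • g i)) h
    rw [← MvPolynomial.pderiv_map] at this
    simp only [eq_intCast] at this
    rw [this, map_sum]
    have e1 : ∑ i, pderiv j (b i • g i) = ∑ i, b i • pderiv j (g i) := by
      apply Finset.sum_congr rfl; intro i _; rw [Derivation.map_smul]
    rw [e1, waM_sum, h0 h hh j, Int.cast_zero]
  · gcongr

lemma wa_dichotomy {R : ℕ} (T : Set (Fin R → ℤ)) :
    (∃ v : Fin R → Fin R → ℤ, (∀ l, v l ∈ T) ∧ (Matrix.of v).det ≠ 0) ∨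
    (∃ b : Fin R → ℤ, b ≠ 0 ∧ ∀ v ∈ T, ∑ i, b i * v i = 0) := by
  classical
  let φ : (Fin R → ℤ) → (Fin R → ℚ) := fun v i => (v i : ℚ)
  by_cases htop : Submodule.span ℚ (φ '' T) = ⊤
  · left
    obtain ⟨f, h1, h2, h3⟩ := Submodule.exists_fun_fin_finrank_span_eq ℚ (φ '' T)
    have hR : Module.finrank ℚ (Submodule.span ℚ (φ '' T)) = R := by
      rw [htop, finrank_top, Module.finrank_fin_fun]
    let f' : Fin R → Fin R → ℚ := fun l => f (Fin.cast hR.symm l)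
    have h1' : ∀ l, ∃ v ∈ T, φ v = f' l := fun l => h1 _
    choose v hv hvf using h1'
    refine ⟨v, hv, ?_⟩
    have h3' : LinearIndependent ℚ f' := h3.comp _ (Fin.cast_injective _)
    have hu : IsUnit (Matrix.of f') := by
      rw [← Matrix.linearIndependent_rows_iff_isUnit]
      exact h3'
    rw [Matrix.isUnit_iff_isUnit_det] at hu
    intro h0
    have : (Matrix.of f').det = (((Matrix.of v).det : ℤ) : ℚ) := by
      have e : Matrix.of f' = (Int.castRingHom ℚ).mapMatrix (Matrix.of v) := by
        ext l i
        simp [← hvf, φ]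
      rw [e, ← RingHom.map_det]; simp
    rw [this, h0] at hu
    simp at hu
  · right
    obtain ⟨f, hf0, hf⟩ := Submodule.exists_le_ker_of_lt_top _ (lt_top_iff_ne_top.mpr htop)
    let c : Fin R → ℚ := fun i => f (Pi.single i 1)
    have hfc : ∀ x, f x = ∑ i, x i * c i := by
      intro x
      conv_lhs => rw [← Finset.univ_sum_single x]
      rw [map_sum]
      apply Finset.sum_congr rfl
      intro i _
      have : (Pi.single i (x i) : Fin R → ℚ) = x i • Pi.single i 1 := by
        rw [← Pi.single_smul]; simp
      rw [this, map_smul, smul_eq_mul]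
    obtain ⟨⟨N, hN⟩, hNc⟩ := IsLocalization.exist_integer_multiples_of_finite (nonZeroDivisors ℤ) c
    choose b hb using hNc
    have hN0 : (N : ℚ) ≠ 0 := by exact_mod_cast nonZeroDivisors.ne_zero hN
    have hb' : ∀ i, (b i : ℚ) = N * c i := by
      intro i
      have := hb i
      simpa [Submonoid.smul_def] using this
    refine ⟨b, ?_, ?_⟩
    · intro h0
      apply hf0
      ext i
      have := hb' i
      rw [h0] at this
      simp only [Pi.zero_apply, Int.cast_zero] at this
      have hc : c i = 0 := by
        rcases mul_eq_zero.mp this.symm with h | h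
        · exact absurd h hN0
        · exact h
      simpa [c] using hc
    · intro v hv
      have h1 : f (φ v) = 0 := hf (Submodule.subset_span ⟨v, hv, rfl⟩)
      rw [hfc] at h1
      have : ((∑ i, b i * v i : ℤ) : ℚ) = N * ∑ i, φ v i * c i := by
        push_cast
        rw [Finset.mul_sum]
        apply Finset.sum_congr rfl
        intro i _
        rw [hb']; simp only [φ]; ring
      rw [h1, mul_zero] at this
      exact_mod_cast this

lemma wa_det_bound {R : ℕ} (A : Matrix (Fin R) (Fin R) ℝ) (w : Fin R → ℝ)
    (h : ∀ l i, |A l i| ≤ w i) : |A.det| ≤ R.factorial * ∏ i, w i := by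
  rw [Matrix.det_apply]
  refine (Finset.abs_sum_le_sum_abs _ _).trans ?_
  have : ∀ σ ∈ (Finset.univ : Finset (Equiv.Perm (Fin R))),
      |Equiv.Perm.sign σ • ∏ i, A (σ i) i| ≤ ∏ i, w i := by
    intro σ _
    have : |Equiv.Perm.sign σ • ∏ i, A (σ i) i| = |∏ i, A (σ i) i| := by
      rcases Int.units_eq_one_or (Equiv.Perm.sign σ) with h | h <;> simp [h]
    rw [this, Finset.abs_prod]
    exact Finset.prod_le_prod (fun _ _ => abs_nonneg _) fun i _ => h _ _
  refine (Finset.sum_le_card_nsmul _ _ _ this).trans ?_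
  rw [nsmul_eq_mul, Finset.card_univ, Fintype.card_perm, Fintype.card_fin]

lemma wa_rational {R : ℕ} (v : Fin R → Fin R → ℤ) (hdet : (Matrix.of v).det ≠ 0) (E η : ℝ)
    (hE : ∀ l i, |(v l i : ℝ)| ≤ E) (α : Fin R → ℝ) (hα : ∀ i, 0 ≤ α i)
    (hη : ∀ l, ∃ m : ℤ, |∑ i, α i * (v l i : ℝ) - m| ≤ η) :
    ∃ (a : Fin R → ℕ) (q : ℕ), 0 < q ∧ Nat.gcd (Finset.univ.gcd a) q = 1 ∧
      (∀ i, |(q : ℝ) * α i - (a i : ℝ)| ≤ R.factorial * (η * E ^ (R - 1))) ∧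
      (q : ℝ) ≤ R.factorial * E ^ R := by
  classical
  choose m hm using hη
  let A : Matrix (Fin R) (Fin R) ℤ := Matrix.of v
  let A' : Matrix (Fin R) (Fin R) ℝ := A.map (Int.cast)
  have hA'det : A'.det = (A.det : ℝ) := by
    have := RingHom.map_det (Int.castRingHom ℝ) A
    simp only [eq_intCast] at this
    rw [this]; rfl
  have hdetb : |(A.det : ℝ)| ≤ R.factorial * E ^ R := by
    rw [← hA'det]
    have := wa_det_bound A' (fun _ => E) (fun l i => hE l i)
    simpa using this
  let ρ : Fin R → ℝ := fun l => ∑ i, α i * (v l i : ℝ) - m l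
  have key : ∀ i, (A.det : ℝ) * α i - (A.cramer m i : ℤ) = (A'.cramer ρ) i := by
    intro i
    have e1 : ρ = A'.mulVec α - (fun l => (m l : ℝ)) := by
      ext l
      simp only [ρ, Matrix.mulVec, dotProduct, Pi.sub_apply, A', A, Matrix.map_apply, Matrix.of_apply]
      congr 1
      exact Finset.sum_congr rfl fun i _ => mul_comm _ _
    have e2 : A'.cramer (fun l => (m l : ℝ)) i = ((A.cramer m i : ℤ) : ℝ) := by
      rw [Matrix.cramer_apply, Matrix.cramer_apply]
      have := RingHom.map_det (Int.castRingHom ℝ) (A.updateCol i m)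
      simp only [eq_intCast] at this
      rw [this]
      congr 1
      ext l k
      simp only [RingHom.mapMatrix_apply, Matrix.map_apply, Matrix.updateCol_apply, A']
      split_ifs <;> simp
    have e3 : A'.cramer (A'.mulVec α) = A'.det • α := by
      rw [Matrix.cramer_eq_adjugate_mulVec, Matrix.mulVec_mulVec, Matrix.adjugate_mul, Matrix.smul_mulVec, Matrix.one_mulVec]
    rw [e1, map_sub, e3, Pi.sub_apply, e2, hA'det]; simp
  have hb : ∀ i, |(A.det : ℝ) * α i - (A.cramer m i : ℤ)| ≤ R.factorial * (η * E ^ (R - 1)) := by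
    intro i
    rw [key, Matrix.cramer_apply]
    refine (wa_det_bound _ (fun k => if k = i then η else E) ?_).trans (le_of_eq ?_)
    · intro l k
      rw [Matrix.updateCol_apply]
      split_ifs
      · exact hm l
      · exact hE l k
    · congr 1
      rw [← Finset.mul_prod_erase _ _ (Finset.mem_univ i), if_pos rfl]
      congr 1
      rw [Finset.prod_congr rfl (g := fun _ => E)]
      · simp
      · intro k hk
        rw [if_neg (Finset.ne_of_mem_erase hk)]
  -- absolute values
  let q0 : ℕ := A.det.natAbs
  have hq0 : 0 < q0 := Int.natAbs_pos.mpr hdet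
  have hq0r : (q0 : ℝ) = |(A.det : ℝ)| := by
    simp only [q0]; rw [Nat.cast_natAbs, Int.cast_abs]
  have hz : ∀ i, ∃ z : ℤ, |(q0 : ℝ) * α i - z| ≤ R.factorial * (η * E ^ (R - 1)) := by
    intro i
    rcases abs_choice (A.det : ℝ) with h | h
    · exact ⟨A.cramer m i, by rw [hq0r, h]; exact hb i⟩
    · refine ⟨-A.cramer m i, ?_⟩
      rw [hq0r, h, ← abs_neg, Int.cast_neg]
      convert hb i using 2
      ring
  choose z hz using hz
  let a0 : Fin R → ℕ := fun i => (z i).toNat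
  have ha0 : ∀ i, |(q0 : ℝ) * α i - a0 i| ≤ R.factorial * (η * E ^ (R - 1)) := by
    intro i
    refine le_trans ?_ (hz i)
    by_cases h : 0 ≤ z i
    · have : ((a0 i : ℕ) : ℝ) = (z i : ℝ) := by
        have := Int.toNat_of_nonneg h
        exact_mod_cast this
      rw [this]
    · push Not at h
      have : a0 i = 0 := Int.toNat_of_nonpos h.le
      rw [this]
      have h1 : (0:ℝ) ≤ q0 * α i := mul_nonneg (Nat.cast_nonneg _) (hα i)
      have h2 : (z i : ℝ) < 0 := by exact_mod_cast h
      rw [Nat.cast_zero, sub_zero, abs_of_nonneg h1, abs_of_nonneg (by linarith)]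
      linarith
  let g : ℕ := Nat.gcd (Finset.univ.gcd a0) q0
  have hg : 0 < g := Nat.gcd_pos_of_pos_right _ hq0
  have hga : ∀ i, g ∣ a0 i := fun i => (Nat.gcd_dvd_left _ _).trans (Finset.gcd_dvd (Finset.mem_univ i))
  have hgq : g ∣ q0 := Nat.gcd_dvd_right _ _
  choose a ha using hga
  obtain ⟨q, hq⟩ := hgq
  have hgr : (1:ℝ) ≤ g := by exact_mod_cast hg
  refine ⟨a, q, ?_, ?_, ?_, ?_⟩
  · apply Nat.pos_of_ne_zero
    rintro rfl
    omega
  · have h1 : Finset.univ.gcd a0 = g * Finset.univ.gcd a := by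
      have : a0 = fun i => g * a i := funext ha
      rw [this, Finset.gcd_mul_left]; simp
    have h2 : g = g * Nat.gcd (Finset.univ.gcd a) q := by
      rw [← Nat.gcd_mul_left, ← h1, ← hq]
    exact Nat.eq_of_mul_eq_mul_left hg (by rw [mul_one]; exact h2.symm)
  · intro i
    refine le_trans ?_ (ha0 i)
    rw [ha i, hq]
    push_cast
    have : (g:ℝ) * q * α i - g * a i = g * (q * α i - a i) := by ring
    rw [this, abs_mul, abs_of_nonneg (by linarith : (0:ℝ) ≤ g)]
    exact le_mul_of_one_le_left (abs_nonneg _) hgr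
  · refine le_trans ?_ hdetb
    rw [← hq0r, hq]
    push_cast
    exact le_mul_of_one_le_left (Nat.cast_nonneg _) hgr

lemma wa_analytic (n r' s : ℕ) (hn : 0 < n) (κ ε θ : ℝ) (hκ : 0 < κ) (hκ1 : κ ≤ 1) (hε : 0 < ε) (hθ0 : 0 < θ) :
    ∃ c : ℝ, 0 < c ∧ ∀ (Δ : ℕ), Δ ≤ n → ∀ P : ℝ, 1 ≤ P → ∀ (M B : ℕ) (S : ℝ), 0 ≤ S → 1 ≤ M → (M:ℝ) ≤ P →
      (B : ℝ) ≤ 2 * P ^ θ →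
      S ^ (2^(r'+1)) ≤ ((2*(M:ℝ)+1)^n)^(2^(r'+1)-(r'+1)-1) *
        ((4*((8*n*M : ℕ):ℝ)*(1+Real.log ((8*n*M : ℕ):ℝ)))^n *
          (((3/(κ * P^(θ-1)))^n)^(r'+1) *
            ((s:ℝ) ^ ((r'+1)*n) * (((r'+1:ℕ):ℝ)*n*(2*B)+1)^(r'*n+Δ)))) →
      S ≤ c * P ^ ((n:ℝ) - ((n:ℝ) - Δ) / 2^(r'+1) * θ + ε) := by
  set N : ℕ := 2^(r'+1) with hN
  have hNr : r' + 2 ≤ N := by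
    have := Nat.lt_two_pow_self (n := r'+1)
    omega
  have hN0 : 0 < N := by omega
  have hnr : (0:ℝ) < n := by exact_mod_cast hn
  have hNR : (0:ℝ) < N := by exact_mod_cast hN0
  set ε1 : ℝ := ε * N / n with hε1
  have hεpos : 0 < ε1 := by positivity
  set c1 : ℝ := 1 + (8*n)^ε1/ε1 with hc1
  have hc1p : 0 < c1 := by positivity
  set c2 : ℝ := (r'+1)*n*4+1 with hc2
  have hc2p : 1 ≤ c2 := by
    have : (0:ℝ) ≤ (r'+1)*n*4 := by positivity
    linarith
  set c : ℝ := (3^n)^(N-(r'+1)-1) * ((32*n*c1)^n * (((3/κ)^n)^(r'+1) * ((s:ℝ)^((r'+1)*n) * c2^(r'*n+n)))) with hc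
  have hcp : 0 ≤ c := by positivity
  refine ⟨max c 1, lt_max_of_lt_right one_pos, ?_⟩
  intro Δ hΔ P hP M B S hS hM hMP hB hmain
  have hP0 : 0 < P := by linarith
  have hM1 : (1:ℝ) ≤ M := by exact_mod_cast hM
  have hn1 : (1:ℝ) ≤ n := by exact_mod_cast hn
  have b1 : 2*(M:ℝ)+1 ≤ 3*P := by linarith
  have hQ : ((8*n*M : ℕ):ℝ) = 8*n*M := by push_cast; ring
  have hQ1 : (1:ℝ) ≤ 8*n*M := by nlinarith
  have b2 : 1+Real.log (8*n*M) ≤ c1 * P^ε1 := by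
    have h1 : Real.log (8*n*M) ≤ (8*n*M)^ε1/ε1 := Real.log_le_rpow_div (by linarith) hεpos
    have h2 : (8*n*M : ℝ)^ε1 ≤ (8*n)^ε1 * P^ε1 := by
      rw [← Real.mul_rpow (by positivity) hP0.le]
      apply Real.rpow_le_rpow (by positivity) _ hεpos.le
      gcongr
    have h3 : (1:ℝ) ≤ P^ε1 := Real.one_le_rpow hP hεpos.le
    have h4 : (8*n*M : ℝ)^ε1/ε1 ≤ (8*n)^ε1/ε1 * P^ε1 := by
      rw [div_mul_eq_mul_div]; gcongr
    rw [hc1]; linarith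
  have b2' : 0 ≤ 1+Real.log (8*n*M) := by
    have := Real.log_nonneg hQ1; linarith
  have b3 : 4*(8*n*M:ℝ)*(1+Real.log (8*n*M)) ≤ 32*n*c1*(P * P^ε1) := by
    calc 4*(8*n*M:ℝ)*(1+Real.log (8*n*M)) ≤ 4*(8*n*P:ℝ)*(c1 * P^ε1) := by gcongr
      _ = _ := by ring
  have b4 : 3/(κ * P^(θ-1)) = 3/κ * P^(1-θ) := by
    have : P^(1-θ) = (P^(θ-1))⁻¹ := by rw [← Real.rpow_neg hP0.le]; congr 1; ring
    rw [this]; field_simp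
  have b5 : ((r'+1:ℕ):ℝ)*n*(2*B)+1 ≤ c2 * P^θ := by
    have h3 : (1:ℝ) ≤ P^θ := Real.one_le_rpow hP hθ0.le
    have : ((r'+1:ℕ):ℝ)*n*(2*B) ≤ ((r'+1:ℕ):ℝ)*n*(2*(2*P^θ)) := by gcongr
    rw [hc2]
    push_cast at this ⊢
    nlinarith
  rw [hQ, b4] at hmain
  have step : S^N ≤ ((3*P)^n)^(N-(r'+1)-1) * ((32*n*c1*(P * P^ε1))^n * (((3/κ * P^(1-θ))^n)^(r'+1) *
      ((s:ℝ)^((r'+1)*n) * (c2 * P^θ)^(r'*n+Δ)))) := by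
    refine hmain.trans ?_
    gcongr
  have b6 : c2^(r'*n+Δ) ≤ c2^(r'*n+n) := pow_le_pow_right₀ hc2p (by omega)
  set e : ℝ := (n:ℝ) - ((n:ℝ) - Δ) / 2^(r'+1) * θ + ε with he
  have b7 : (P^n)^(N-(r'+1)-1) * ((P * P^ε1)^n * (((P^(1-θ))^n)^(r'+1) * (P^θ)^(r'*n+Δ))) = (P^e)^N := by
    rw [← Real.rpow_natCast P n, ← Real.rpow_natCast _ (N-(r'+1)-1), ← Real.rpow_mul hP0.le]
    nth_rewrite 2 [← Real.rpow_one P]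
    rw [← Real.rpow_add hP0, ← Real.rpow_natCast _ n, ← Real.rpow_mul hP0.le, ← Real.rpow_natCast (P^(1-θ)) n,
      ← Real.rpow_mul hP0.le, ← Real.rpow_natCast _ (r'+1), ← Real.rpow_mul hP0.le,
      ← Real.rpow_natCast _ (r'*n+Δ), ← Real.rpow_mul hP0.le, ← Real.rpow_natCast _ N, ← Real.rpow_mul hP0.le,
      ← Real.rpow_add hP0, ← Real.rpow_add hP0, ← Real.rpow_add hP0]
    congr 1
    have hsub : ((N-(r'+1)-1 : ℕ) : ℝ) = N - (r'+1) - 1 := by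
      rw [Nat.cast_sub (by omega), Nat.cast_sub (by omega)]; push_cast; ring
    have h2N : (2:ℝ)^(r'+1) = N := by rw [hN]; push_cast; ring
    rw [hsub, he, h2N, hε1]
    push_cast
    field_simp
    ring
  have step2 : S^N ≤ c * (P^e)^N := by
    refine step.trans ?_
    rw [← b7, hc]
    have : ((3*P)^n)^(N-(r'+1)-1) * ((32*n*c1*(P * P^ε1))^n * (((3/κ * P^(1-θ))^n)^(r'+1) *
      ((s:ℝ)^((r'+1)*n) * (c2 * P^θ)^(r'*n+Δ)))) = ((3^n)^(N-(r'+1)-1) * ((32*n*c1)^n * (((3/κ)^n)^(r'+1) * ((s:ℝ)^((r'+1)*n) * c2^(r'*n+Δ))))) * ((P^n)^(N-(r'+1)-1) * ((P * P^ε1)^n * (((P^(1-θ))^n)^(r'+1) * (P^θ)^(r'*n+Δ)))) := by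
      simp only [mul_pow]; ring
    rw [this]
    gcongr
  have hPe : 0 ≤ P^e := by positivity
  have step3 : S^N ≤ (max c 1 * P^e)^N := by
    refine step2.trans ?_
    rw [mul_pow]
    gcongr
    exact (le_max_left c 1).trans (le_self_pow₀ (le_max_right c 1) hN0.ne')
  exact le_of_pow_le_pow_left₀ hN0.ne' (by positivity) step3

section waFinal
variable {n R : ℕ}

/-- the real polynomial `α · f` -/
def waPhase (f : Fin R → MvPolynomial (Fin n) ℤ) (α : Fin R → ℝ) : MvPolynomial (Fin n) ℝ :=
  ∑ i, α i • MvPolynomial.map (Int.castRingHom ℝ) (f i)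

lemma waPhase_eval (f : Fin R → MvPolynomial (Fin n) ℤ) (α : Fin R → ℝ) (x : Fin n → ℤ) :
    eval (fun i => (x i : ℝ)) (waPhase f α) = ∑ i, α i * (MvPolynomial.eval x (f i) : ℝ) := by
  unfold waPhase
  rw [map_sum]
  apply Finset.sum_congr rfl
  intro i _
  rw [smul_eval, eval_map]
  congr 1
  have := MvPolynomial.eval₂_comp_left (Int.castRingHom ℝ) (RingHom.id ℤ) x (f i)
  simp only [eq_intCast] at this
  exact this.symm

lemma waPhase_deg (f : Fin R → MvPolynomial (Fin n) ℤ) (α : Fin R → ℝ) (d : ℕ)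
    (hf : ∀ i, (f i).totalDegree = d) : waDegLt (d+1) (waPhase f α) := by
  unfold waPhase
  apply waDegLt.sum
  intro i _
  apply waDegLt.smul
  intro m hm
  rw [coeff_map] at hm
  have h1 : coeff m (f i) ≠ 0 := by
    intro h; simp [h] at hm
  have := le_totalDegree (mem_support_iff.mpr h1)
  rw [hf i, Finsupp.sum_fintype _ _ (by simp)] at this
  rw [Finsupp.degree_eq_sum]
  omega

lemma waPhase_M (f : Fin R → MvPolynomial (Fin n) ℤ) (α : Fin R → ℝ) (r : ℕ) (j : Fin n)
    (h : Fin r → Fin n → ℤ) :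
    waM (pderiv j (waPhase f α)) (fun k i => (h k i : ℝ)) =
      ∑ i, α i * ((waM (pderiv j (homogeneousComponent (r+1) (f i))) h : ℤ) : ℝ) := by
  unfold waPhase
  rw [map_sum]
  have e1 : ∑ i, pderiv j (α i • MvPolynomial.map (Int.castRingHom ℝ) (f i)) =
      ∑ i, α i • MvPolynomial.map (Int.castRingHom ℝ) (pderiv j (f i)) := by
    apply Finset.sum_congr rfl; intro i _; rw [Derivation.map_smul, pderiv_map]
  rw [e1, waM_sum]
  apply Finset.sum_congr rfl
  intro i _
  congr 1
  have := waM_map (Int.castRingHom ℝ) (pderiv j (f i)) h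
  simp only [eq_intCast] at this
  rw [this]
  congr 1
  apply waM_congr
  intro m hm
  rw [coeff_pderiv, coeff_pderiv, coeff_homogeneousComponent, if_pos]
  rw [map_add, hm]; simp

lemma wa_coeff_pderiv (f : Fin R → MvPolynomial (Fin n) ℤ) (Ct : ℝ) (hC0 : 0 ≤ Ct) (hCt : coeffMax f Ct) (r : ℕ)
    (i : Fin R) (j : Fin n) (m : Fin n →₀ ℕ) (hm : m.degree = r) :
    |((coeff m (pderiv j (f i)) : ℤ) : ℝ)| ≤ ((r:ℝ)+1) * Ct := by
  rw [coeff_pderiv]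
  have h1 := hCt.2 ⟨i, m + Finsupp.single j 1, rfl⟩
  have h2 : (m j : ℝ) + 1 ≤ (r:ℝ) + 1 := by
    have := Finsupp.le_degree j m
    rw [hm] at this
    have : (m j : ℝ) ≤ r := by exact_mod_cast this
    linarith
  push_cast
  rw [abs_mul, abs_of_nonneg (by positivity : (0:ℝ) ≤ (m j : ℝ) + 1), mul_comm]
  gcongr

end waFinal

set_option maxHeartbeats 4000000

/-- **Lemma 2.1 (Weyl alternative).** -/
theorem weyl_alternative (n R d : ℕ) (hR : 0 < R) (hd : 2 ≤ d) (hnR : R < n)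
    (ε θ : ℝ) (hε : 0 < ε) (hθ0 : 0 < θ) (hθ1 : θ < 1) :
    ∃ c : ℝ, 0 < c ∧
      ∀ (f : Fin R → MvPolynomial (Fin n) ℤ),
        (∀ i, (f i).totalDegree = d) →
        ∀ Ct K : ℝ, 1 ≤ Ct →
        coeffMax (fun i => MvPolynomial.homogeneousComponent d (f i)) Ct →
        KofDelta n R d (fun i => MvPolynomial.homogeneousComponent d (f i)) K →
        ∀ (aB bB : Fin n → ℝ),
        (∀ j, -1 ≤ aB j ∧ 0 < bB j - aB j ∧ bB j - aB j < 1 ∧ bB j ≤ 1) →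
        ∀ (α : Fin R → ℝ), (∀ i, 0 ≤ α i ∧ α i < 1) →
        ∀ P : ℝ, 1 ≤ P →
          ‖Sexp f aB bB P α‖ ≤ c * P ^ ((n : ℝ) - K * θ + ε) ∨
          ∃ (a : Fin R → ℕ) (q : ℕ), 0 < q ∧
            Nat.gcd (Finset.univ.gcd a) q = 1 ∧
            (∀ i, |(q : ℝ) * α i - (a i : ℝ)| ≤
              Ct ^ (R - 1) * P ^ (-(d : ℝ) + (R : ℝ) * ((d : ℝ) - 1) * θ)) ∧
            (q : ℝ) ≤ Ct ^ R * P ^ ((R : ℝ) * ((d : ℝ) - 1) * θ) := by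
  classical
  obtain ⟨r', rfl⟩ : ∃ r', d = r' + 2 := ⟨d - 2, by omega⟩
  have hn : 0 < n := by omega
  obtain ⟨s, hs⟩ := wa_final_count n r'
  set W : ℝ := (n:ℝ)^(r'+1) * ((r'+1).factorial * (((r'+1:ℕ):ℝ)+1)) with hW
  have hn1 : (1:ℝ) ≤ n := by exact_mod_cast hn
  have hfac : (1:ℝ) ≤ (r'+1).factorial := by exact_mod_cast Nat.factorial_pos _
  have hRfac : (1:ℝ) ≤ R.factorial := by exact_mod_cast Nat.factorial_pos _
  have hW1 : 1 ≤ W := by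
    have h1 : (1:ℝ) ≤ (n:ℝ)^(r'+1) := one_le_pow₀ hn1
    have h2 : (1:ℝ) ≤ ((r'+1:ℕ):ℝ)+1 := by
      have : (0:ℝ) ≤ ((r'+1:ℕ):ℝ) := Nat.cast_nonneg _
      linarith
    rw [hW]
    exact one_le_mul_of_one_le_of_one_le h1 (one_le_mul_of_one_le_of_one_le hfac h2)
  have hWR : 1 ≤ W * R.factorial := one_le_mul_of_one_le_of_one_le hW1 hRfac
  set κ : ℝ := 1 / (2 * (W * R.factorial)) with hκ
  have hκ0 : 0 < κ := by positivity
  have hκ2 : 2 * κ * (W * R.factorial) = 1 := by rw [hκ]; field_simp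
  have hκ1 : 2 * κ ≤ 1 := by nlinarith
  obtain ⟨c, hc, hcc⟩ := wa_analytic n r' s hn κ ε θ hκ0 (by linarith) hε hθ0
  refine ⟨c, hc, ?_⟩
  intro f hf Ct K hCt1 hCt hK aB bB hbox α hα P hP
  obtain ⟨Δ, hΔ, rfl⟩ := hK
  have hΔn := wa_delta_le _ Δ hΔ
  have hP0 : 0 < P := by linarith
  set M : ℕ := ⌊P⌋₊ with hM
  have hMP : (M:ℝ) ≤ P := Nat.floor_le hP0.le
  have hM1 : 1 ≤ M := Nat.le_floor (by exact_mod_cast hP)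
  have hM1r : (1:ℝ) ≤ M := by exact_mod_cast hM1
  have hPM : P ≤ 2 * M := by
    have := Nat.lt_floor_add_one P
    rw [← hM] at this
    linarith
  set Q : ℕ := 8 * n * M with hQ
  have hQr : (Q:ℝ) = 8 * n * M := by rw [hQ]; push_cast; ring
  have hnM : (M:ℝ) ≤ n * M := by nlinarith
  have hQP : P ≤ Q := by rw [hQr]; linarith
  have hQ0 : (0:ℝ) < Q := by linarith
  set t : ℝ := κ * P^(θ-1) with ht
  have ht0 : 0 < t := by positivity
  have hPθ : P^(θ-1) ≤ 1 := Real.rpow_le_one_of_one_le_of_nonpos hP (by linarith)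
  have ht1 : t ≤ 1 := by
    calc t ≤ κ * 1 := by rw [ht]; gcongr
      _ ≤ 1 := by linarith
  have hH0 : (0:ℝ) < 2 * M := by linarith
  set Bd : ℝ := t * (2 * M) with hBd
  have hBd0 : 0 ≤ Bd := by positivity
  have hPP : P^(θ-1) * P = P^θ := by
    nth_rewrite 2 [← Real.rpow_one P]
    rw [← Real.rpow_add hP0]; congr 1; ring
  have hBd1 : Bd ≤ 2 * κ * P^θ := by
    calc Bd ≤ t * (2 * P) := by rw [hBd]; gcongr
      _ = 2 * κ * (P^(θ-1) * P) := by rw [ht]; ring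
      _ = _ := by rw [hPP]
  set η : ℝ := t^(r'+1) * (1/Q) with hη
  set p := waPhase f α with hp
  set X := waCnt p (fun _ : Fin (r'+1) => Bd) η with hX
  have hXm : ∀ h, h ∈ X ↔ _ := fun h => mem_waCnt (p := p) (δ := η) (H := fun _ : Fin (r'+1) => Bd) (h := h) (fun _ => hBd0)
  let g : Fin R → MvPolynomial (Fin n) ℤ := fun i => homogeneousComponent (r'+2) (f i)
  let T : Set (Fin R → ℤ) := {v | ∃ h ∈ X, ∃ j, v = fun i => waM (pderiv j (g i)) h}
  rcases wa_dichotomy T with ⟨v, hvT, hdet⟩ | ⟨b, hb0, hbT⟩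
  · right
    set E : ℝ := (n:ℝ)^(r'+1) * ((r'+1).factorial * ((((r'+1:ℕ):ℝ)+1)*Ct) * Bd^(r'+1)) with hE
    have hE0 : 0 ≤ E := by positivity
    obtain ⟨a, q, hq, hgcd, ha, hqb⟩ := wa_rational v hdet E η (by
      intro l i
      obtain ⟨h, hh, j, hv⟩ := hvT l
      rw [hv]
      apply waM_bound _ _ _ hBd0 _ h ((hXm h).mp hh).1
      intro m hm
      exact wa_coeff_pderiv _ Ct (by linarith) hCt _ i j m hm) α (fun i => (hα i).1) (by
      intro l
      obtain ⟨h, hh, j, hv⟩ := hvT l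
      obtain ⟨z, hz⟩ := ((hXm h).mp hh).2 j
      refine ⟨z, ?_⟩
      rw [hp, waPhase_M] at hz
      rw [hv]
      exact hz)
    have hPr : (P^θ)^(r'+1) = P^(((r':ℝ)+1)*θ) := by
      rw [← Real.rpow_natCast, ← Real.rpow_mul hP0.le]; congr 1; push_cast; ring
    have hEb : E ≤ (1/R.factorial) * (Ct * P^(((r':ℝ)+1)*θ)) := by
      have h1 : Bd^(r'+1) ≤ (2*κ) * P^(((r':ℝ)+1)*θ) := by
        calc Bd^(r'+1) ≤ (2 * κ * P^θ)^(r'+1) := by gcongr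
          _ = (2*κ)^(r'+1) * P^(((r':ℝ)+1)*θ) := by rw [mul_pow, hPr]
          _ ≤ _ := by
            gcongr
            exact pow_le_of_le_one (by positivity) hκ1 (by omega)
      calc E = W * Ct * Bd^(r'+1) := by rw [hE, hW]; ring
        _ ≤ W * Ct * ((2*κ) * P^(((r':ℝ)+1)*θ)) := by gcongr
        _ = (2 * κ * (W * R.factorial)) * (1/R.factorial) * (Ct * P^(((r':ℝ)+1)*θ)) := by field_simp
        _ = _ := by rw [hκ2, one_mul]
    have hηb : η ≤ κ * P^(-((r':ℝ)+2) + ((r':ℝ)+1)*θ) := by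
      have h1 : t^(r'+1) ≤ κ * P^(((r':ℝ)+1)*(θ-1)) := by
        rw [ht, mul_pow, ← Real.rpow_natCast (P^(θ-1)), ← Real.rpow_mul hP0.le]
        have : (θ-1) * ((r'+1:ℕ):ℝ) = ((r':ℝ)+1)*(θ-1) := by push_cast; ring
        rw [this]
        gcongr
        exact pow_le_of_le_one hκ0.le (by linarith) (by omega)
      have h2 : (1:ℝ)/Q ≤ P^(-1:ℝ) := by
        rw [Real.rpow_neg_one, ← one_div]
        exact one_div_le_one_div_of_le hP0 hQP
      calc η ≤ (κ * P^(((r':ℝ)+1)*(θ-1))) * P^(-1:ℝ) := by rw [hη]; gcongr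
        _ = κ * (P^(((r':ℝ)+1)*(θ-1)) * P^(-1:ℝ)) := by ring
        _ = _ := by rw [← Real.rpow_add hP0]; congr 2; ring
    have hη0 : 0 ≤ η := by positivity
    have hpow : ∀ m : ℕ, E^m ≤ (1/R.factorial)^m * (Ct^m * P^((m:ℝ) * (((r':ℝ)+1)*θ))) := by
      intro m
      calc E^m ≤ ((1/R.factorial) * (Ct * P^(((r':ℝ)+1)*θ)))^m := by gcongr
        _ = _ := by
          rw [mul_pow, mul_pow, ← Real.rpow_natCast (P^(((r':ℝ)+1)*θ)), ← Real.rpow_mul hP0.le]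
          congr 3; ring
    have hinv0 : (0:ℝ) ≤ 1/R.factorial := by positivity
    have hinv1 : (1:ℝ)/R.factorial ≤ 1 := by
      rw [div_le_one (by linarith)]; exact hRfac
    refine ⟨a, q, hq, hgcd, fun i => (ha i).trans ?_, hqb.trans ?_⟩
    · have hκR : R.factorial * κ ≤ 1 := by nlinarith
      have h1 : E^(R-1) ≤ Ct^(R-1) * P^(((R-1:ℕ):ℝ) * (((r':ℝ)+1)*θ)) := by
        refine (hpow (R-1)).trans ?_
        apply mul_le_of_le_one_left (by positivity)
        exact pow_le_one₀ hinv0 hinv1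
      calc (R.factorial:ℝ) * (η * E^(R-1)) ≤ R.factorial * ((κ * P^(-((r':ℝ)+2) + ((r':ℝ)+1)*θ)) *
            (Ct^(R-1) * P^(((R-1:ℕ):ℝ) * (((r':ℝ)+1)*θ)))) := by gcongr
        _ = (R.factorial * κ) * (Ct^(R-1) * (P^(-((r':ℝ)+2) + ((r':ℝ)+1)*θ) *
            P^(((R-1:ℕ):ℝ) * (((r':ℝ)+1)*θ)))) := by ring
        _ ≤ 1 * (Ct^(R-1) * (P^(-((r':ℝ)+2) + ((r':ℝ)+1)*θ) *
            P^(((R-1:ℕ):ℝ) * (((r':ℝ)+1)*θ)))) := by gcongr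
        _ = _ := by
          rw [one_mul, ← Real.rpow_add hP0]
          congr 2
          rw [Nat.cast_sub (by omega)]
          push_cast
          ring
    · calc (R.factorial:ℝ) * E^R ≤ R.factorial * ((1/R.factorial)^R * (Ct^R * P^((R:ℝ) * (((r':ℝ)+1)*θ)))) := by
            gcongr
            exact hpow R
        _ ≤ R.factorial * ((1/R.factorial) * (Ct^R * P^((R:ℝ) * (((r':ℝ)+1)*θ)))) := by
            gcongr
            exact pow_le_of_le_one hinv0 hinv1 (by omega)
        _ = Ct^R * P^((R:ℝ) * (((r':ℝ)+1)*θ)) := by field_simp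
        _ = _ := by
          congr 2
          push_cast; ring
  · left
    have hB : ∀ h ∈ X, ∀ k i, |h k i| ≤ (⌊Bd⌋₊ : ℕ) := by
      intro h hh k i
      have h1 := ((hXm h).mp hh).1 k i
      have h2 : ((h k i).natAbs : ℝ) ≤ Bd := by
        rw [Nat.cast_natAbs, Int.cast_abs]; exact h1
      have h3 := Nat.le_floor h2
      rw [Int.abs_eq_natAbs]
      exact_mod_cast h3
    have hcount := hs R g (fun i => homogeneousComponent_isHomogeneous _ _) Δ hΔ b hb0 X ⌊Bd⌋₊ hB
      (fun h hh j => hbT _ ⟨h, hh, j, rfl⟩)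
    have hcount' : (X.card:ℝ) ≤ (s:ℝ) ^ ((r'+1)*n) * (((r'+1:ℕ):ℝ)*n*(2*(⌊Bd⌋₊:ℕ))+1)^(r'*n+Δ) := by
      have h1 := (Nat.cast_le (α := ℝ)).mpr hcount
      rw [Nat.cast_mul, Nat.cast_pow, Nat.cast_pow, Nat.cast_add, Nat.cast_mul, Nat.cast_mul, Nat.cast_mul,
        Nat.cast_one, Nat.cast_ofNat] at h1
      exact h1
    have hMQ : M + 1 ≤ Q := by
      have h1 : 1 * M ≤ n * M := Nat.mul_le_mul_right _ hn
      have h2 : Q = 8 * (n * M) := by rw [hQ]; ring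
      rw [h2]
      clear_value M
      omega
    have hweyl := wa_weyl_main (r := r'+1) (by omega) p (waPhase_deg f α (r'+2) hf) M Q hMQ (fun j => ⌈P * aB j⌉) (fun j => ⌊P * bB j⌋) (by
      intro j
      have h1 := Int.le_ceil (P * aB j)
      have h2 := Int.floor_le (P * bB j)
      have h3 : P * bB j - P * aB j ≤ P := by
        have h5 : P * (bB j - aB j) ≤ P * 1 := mul_le_mul_of_nonneg_left (hbox j).2.2.1.le hP0.le
        linarith
      have h4 : ((⌊P * bB j⌋ - ⌈P * aB j⌉ : ℤ) : ℝ) ≤ P := by push_cast; linarith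
      rw [hM, Int.natCast_floor_eq_floor hP0.le]
      exact Int.le_floor.mpr h4)
    have hshrink := waCnt_shrink p (2*(M:ℝ)) (1/Q) t hH0 (by positivity) (by
      rw [hQr]
      have : 2 * (n:ℝ) * (2 * M) * (1 / (8 * n * M)) = 1/2 := by field_simp; norm_num
      rw [this]; norm_num) ht0 ht1 (r := r'+1)
    have hSe : Sexp f aB bB P α = ∑ x ∈ Finset.Icc (fun j => ⌈P * aB j⌉) (fun j => ⌊P * bB j⌋),
        eC (eval (fun i => (x i:ℝ)) p) := by
      unfold Sexp boxPts
      apply Finset.sum_congr rfl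
      intro x _
      rw [hp, waPhase_eval]
    have hexp : ((n : ℝ) - ((n:ℝ) - Δ) / 2 ^ (r' + 2 - 1) * θ + ε) = (n:ℝ) - ((n:ℝ) - Δ) / 2^(r'+1) * θ + ε := rfl
    rw [hexp]
    refine hcc Δ hΔn P hP M ⌊Bd⌋₊ _ (norm_nonneg _) hM1 hMP ?_ ?_
    · refine (Nat.floor_le hBd0).trans (hBd1.trans ?_)
      have : (0:ℝ) ≤ P^θ := by positivity
      nlinarith
    · rw [hSe]
      refine hweyl.trans ?_
      have hlog : 0 ≤ 1 + Real.log (Q:ℝ) := by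
        have := Real.log_nonneg (hP.trans hQP); linarith
      rw [← hQ]
      gcongr
      refine hshrink.trans ?_
      gcongr

end
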